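/- arXiv:math/0611073 — 3 statements merged into one kernel-verified Lean document; each statement's English description precedes it below -/
import Mathlib

section
/- Let $d\ge 1$ and $\alpha\in(0,\min(2,d))$. There exist constants $c>0$ and $C>0$ such that for all integers $n\ge 2$ and all $t>0$: $\sup_{x\in Q}\; \|(G_d)^n(t,x,\cdot)\|_{(\alpha)}^2 \le C\, n^{\alpha}\, e^{-ct}$. -/
open MeasureTheory

/-- `φ_j(ξ) = √2 sin(jπξ)`. -/
noncomputable def phiF (j : ℕ) (ξ : ℝ) : ℝ := Real.sqrt 2 * Real.sin ((j : ℝ) * Real.pi * ξ)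

/-- Green function of the heat operator on `[0,1]` with homogeneous
Dirichlet boundary conditions: `G(t,x,y) = ∑_{j≥1} e^{-j²π²t} φ_j(x) φ_j(y)`. -/
noncomputable def G (t x y : ℝ) : ℝ :=
  ∑' j : ℕ, Real.exp (-((j : ℝ) + 1) ^ 2 * Real.pi ^ 2 * t) * phiF (j + 1) x * phiF (j + 1) y

/-- The cube `Q = [0,1]^d`. -/
def Q (d : ℕ) : Set (EuclideanSpace ℝ (Fin d)) := {x | ∀ i, x i ∈ Set.Icc (0 : ℝ) 1}

/-- `G_d(t,x,y) = ∏_i G(t,x_i,y_i)` on `Q = [0,1]^d`. -/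
noncomputable def Gd (d : ℕ) (t : ℝ) (x y : EuclideanSpace ℝ (Fin d)) : ℝ :=
  ∏ i, G t (x i) (y i)

/-- `‖φ‖_{(α)}² = ∫_Q ∫_Q |φ(y)| |y-z|^{-α} |φ(z)| dy dz`. -/
noncomputable def normAlphaSq (d : ℕ) (α : ℝ) (f : EuclideanSpace ℝ (Fin d) → ℝ) : ℝ :=
  ∫ y in Q d, ∫ z in Q d, |f y| * ‖y - z‖ ^ (-α) * |f z|

/-- `κ_n(y) = ⌊ny⌋/n`. -/
noncomputable def kappa (n : ℕ) (y : ℝ) : ℝ := (⌊(n : ℝ) * y⌋ : ℝ) / n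

/-- `λ_j^n = -4n² sin²(jπ/(2n))`. -/
noncomputable def lamn (n j : ℕ) : ℝ :=
  -4 * (n : ℝ) ^ 2 * Real.sin ((j : ℝ) * Real.pi / (2 * n)) ^ 2

/-- Piecewise-linear interpolation of `φ_j` on the grid `{i/n : 0 ≤ i ≤ n}`. -/
noncomputable def phiLin (n j : ℕ) (x : ℝ) : ℝ :=
  phiF j ((⌊(n : ℝ) * x⌋ : ℝ) / n) +
    ((n : ℝ) * x - (⌊(n : ℝ) * x⌋ : ℝ)) *
      (phiF j (((⌊(n : ℝ) * x⌋ : ℝ) + 1) / n) - phiF j ((⌊(n : ℝ) * x⌋ : ℝ) / n))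

/-- Space-discretized Green function on `[0,1]`:
`G^n(t,x,y) = ∑_{j=1}^{n-1} e^{λ_j^n t} φ_j^n(x) φ_j(κ_n(y))`. -/
noncomputable def Gn (n : ℕ) (t x y : ℝ) : ℝ :=
  ∑ j ∈ Finset.Icc 1 (n - 1), Real.exp (lamn n j * t) * phiLin n j x * phiF j (kappa n y)

/-- `(G_d)^n(t,x,y) = ∏_i G^n(t,x_i,y_i)`. -/
noncomputable def Gdn (d n : ℕ) (t : ℝ) (x y : EuclideanSpace ℝ (Fin d)) : ℝ :=
  ∏ i, Gn n t (x i) (y i)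


open Finset in
lemma cos_sum_zero (N : ℕ) (a θ : ℝ) (h : Real.sin (θ / 2) ≠ 0) (m : ℤ)
    (hm : (N : ℝ) * θ = m * (2 * Real.pi)) :
    ∑ k ∈ Finset.range N, Real.cos (a + k * θ) = 0 := by
  have key : ∀ M : ℕ, 2 * Real.sin (θ / 2) * ∑ k ∈ Finset.range M, Real.cos (a + k * θ)
      = Real.sin (a - θ / 2 + M * θ) - Real.sin (a - θ / 2) := by
    intro M
    induction M with
    | zero => simp
    | succ M ih =>
      rw [Finset.sum_range_succ, mul_add, ih]
      have e1 : a - θ / 2 + ((M + 1 : ℕ) : ℝ) * θ = (a + M * θ) + θ / 2 := by push_cast; ring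
      have e2 : a - θ / 2 + (M : ℝ) * θ = (a + M * θ) - θ / 2 := by ring
      rw [e1, e2, Real.sin_add, Real.sin_sub]
      ring
  have h1 := key N
  rw [hm, Real.sin_add_int_mul_two_pi, sub_self] at h1
  have h2 : (2 * Real.sin (θ / 2)) ≠ 0 := by positivity
  exact (mul_eq_zero.mp h1).resolve_left h2

/-- unnormalized periodic kernel -/
noncomputable def Kp (n : ℕ) (t : ℝ) (k : ℤ) : ℝ :=
  ∑ j ∈ Finset.range (2 * n), Real.exp (lamn n j * t) * Real.cos ((j : ℝ) * Real.pi / n * k)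

lemma Pm_nonneg (n : ℕ) (hn : 0 < n) (m : ℕ) : ∀ k : ℤ,
    0 ≤ ∑ j ∈ Finset.range (2 * n), Real.cos ((j : ℝ) * Real.pi / n) ^ m *
      Real.cos ((j : ℝ) * Real.pi / n * k) := by
  have hn' : (n : ℝ) ≠ 0 := by positivity
  induction m with
  | zero =>
    intro k
    by_cases h : Real.sin (Real.pi * k / n / 2) = 0
    · apply Finset.sum_nonneg
      intro j _
      obtain ⟨l, hl⟩ := Real.sin_eq_zero_iff.mp h
      have : (j : ℝ) * Real.pi / n * k = ((j * l : ℤ) : ℝ) * (2 * Real.pi) := by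
        push_cast
        have : Real.pi * k / n = 2 * (l * Real.pi) := by rw [hl]; ring
        calc (j : ℝ) * Real.pi / n * k = j * (Real.pi * k / n) := by ring
          _ = _ := by rw [this]; ring
      rw [this, Real.cos_int_mul_two_pi]; simp
    · have := cos_sum_zero (2 * n) 0 (Real.pi * k / n) h k (by push_cast; field_simp)
      rw [← this]
      apply le_of_eq
      apply Finset.sum_congr rfl
      intro j _
      rw [pow_zero, one_mul]; congr 1; ring
  | succ m ih =>
    intro k
    have h1 := ih (k - 1)
    have h2 := ih (k + 1)
    have : ∑ j ∈ Finset.range (2 * n), Real.cos ((j : ℝ) * Real.pi / n) ^ (m + 1) *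
      Real.cos ((j : ℝ) * Real.pi / n * k) = (∑ j ∈ Finset.range (2 * n), Real.cos ((j : ℝ) * Real.pi / n) ^ m *
      Real.cos ((j : ℝ) * Real.pi / n * (k - 1 : ℤ)) + ∑ j ∈ Finset.range (2 * n), Real.cos ((j : ℝ) * Real.pi / n) ^ m *
      Real.cos ((j : ℝ) * Real.pi / n * (k + 1 : ℤ))) / 2 := by
      rw [← Finset.sum_add_distrib, Finset.sum_div]
      apply Finset.sum_congr rfl
      intro j _
      push_cast
      rw [mul_sub, mul_add, mul_one, Real.cos_sub, Real.cos_add]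
      ring
    rw [this]; linarith

lemma Kp_nonneg (n : ℕ) (hn : 0 < n) (t : ℝ) (ht : 0 ≤ t) (k : ℤ) : 0 ≤ Kp n t k := by
  have hn' : (n : ℝ) ≠ 0 := by positivity
  set s : ℝ := 2 * n ^ 2 * t with hs
  have hs0 : 0 ≤ s := by positivity
  have e : ∀ j : ℕ, Real.exp (lamn n j * t) =
      Real.exp (-s) * Real.exp (s * Real.cos ((j : ℝ) * Real.pi / n)) := by
    intro j
    rw [← Real.exp_add]
    congr 1
    have : (j : ℝ) * Real.pi / n = 2 * ((j : ℝ) * Real.pi / (2 * n)) := by field_simp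
    rw [this, Real.cos_two_mul, Real.cos_sq', lamn, hs]
    ring
  have hK : Kp n t k = Real.exp (-s) * ∑ j ∈ Finset.range (2 * n),
      Real.exp (s * Real.cos ((j : ℝ) * Real.pi / n)) * Real.cos ((j : ℝ) * Real.pi / n * k) := by
    rw [Kp, Finset.mul_sum]
    apply Finset.sum_congr rfl
    intro j _
    rw [e]; ring
  rw [hK]
  apply mul_nonneg (Real.exp_pos _).le
  have hsum : HasSum (fun m : ℕ => ∑ j ∈ Finset.range (2 * n),
      ((s * Real.cos ((j : ℝ) * Real.pi / n)) ^ m / (m.factorial : ℝ)) * Real.cos ((j : ℝ) * Real.pi / n * k))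
      (∑ j ∈ Finset.range (2 * n),
      Real.exp (s * Real.cos ((j : ℝ) * Real.pi / n)) * Real.cos ((j : ℝ) * Real.pi / n * k)) := by
    apply hasSum_sum
    intro j _
    apply HasSum.mul_right
    have := NormedSpace.expSeries_div_hasSum_exp (𝔸 := ℝ) (s * Real.cos ((j : ℝ) * Real.pi / n))
    rwa [← Real.exp_eq_exp_ℝ] at this
  refine hsum.nonneg ?_
  intro m
  have := Pm_nonneg n hn m k
  have e2 : ∑ j ∈ Finset.range (2 * n),
      ((s * Real.cos ((j : ℝ) * Real.pi / n)) ^ m / (m.factorial : ℝ)) * Real.cos ((j : ℝ) * Real.pi / n * k)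
      = s ^ m / (m.factorial : ℝ) * ∑ j ∈ Finset.range (2 * n), Real.cos ((j : ℝ) * Real.pi / n) ^ m *
      Real.cos ((j : ℝ) * Real.pi / n * k) := by
    rw [Finset.mul_sum]
    apply Finset.sum_congr rfl
    intro j _
    rw [mul_pow]; ring
  show 0 ≤ ∑ j ∈ Finset.range (2 * n), _
  rw [e2]
  positivity

lemma Kp_sum (n : ℕ) (hn : 0 < n) (t : ℝ) (i ε : ℤ) (hε : ε = 1 ∨ ε = -1) :
    ∑ k ∈ Finset.range (2 * n), Kp n t (i + ε * k) = 2 * n := by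
  have hn' : (n : ℝ) ≠ 0 := by positivity
  have hn0 : (0 : ℝ) < n := by positivity
  simp only [Kp]
  rw [Finset.sum_comm, Finset.sum_eq_single 0]
  · simp [lamn]
  · intro j hj hj0
    rw [← Finset.mul_sum]
    have hj1 : (j : ℝ) < 2 * n := by exact_mod_cast Finset.mem_range.mp hj
    have hjp : (0 : ℝ) < j := by exact_mod_cast Nat.pos_of_ne_zero hj0
    have hs : 0 < Real.sin ((j : ℝ) * Real.pi / n / 2) := by
      apply Real.sin_pos_of_pos_of_lt_pi
      · positivity
      · rw [div_div, div_lt_iff₀ (by positivity)]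
        nlinarith [Real.pi_pos]
    have := cos_sum_zero (2 * n) ((j : ℝ) * Real.pi / n * i) (ε * ((j : ℝ) * Real.pi / n))
      (by
        rcases hε with rfl | rfl
        · simpa using hs.ne'
        · push_cast
          rw [neg_one_mul, neg_div, Real.sin_neg]
          exact neg_ne_zero.mpr hs.ne') (ε * j) (by push_cast; field_simp)
    have h2 : ∑ k ∈ Finset.range (2 * n), Real.cos ((j : ℝ) * Real.pi / n * ((i + ε * k : ℤ) : ℝ)) = 0 := by
      rw [← this]
      apply Finset.sum_congr rfl
      intro k _
      congr 1; push_cast; ring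
    rw [h2, mul_zero]
  · intro h; exact absurd (Finset.mem_range.mpr (by omega)) h

/-- grid kernel -/
noncomputable def gk (n : ℕ) (t : ℝ) (i k : ℤ) : ℝ :=
  ∑ j ∈ Finset.Icc 1 (n - 1), Real.exp (lamn n j * t) * phiF j ((i : ℝ) / n) * phiF j ((k : ℝ) / n)

lemma gk_eq (n : ℕ) (hn : 0 < n) (t : ℝ) (i k : ℤ) :
    gk n t i k = (Kp n t (i + (-1) * k) - Kp n t (i + 1 * k)) / 2 := by
  have hn' : (n : ℝ) ≠ 0 := by positivity
  set D : ℕ → ℝ := fun j => Real.exp (lamn n j * t) *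
    (2 * (Real.sin ((j : ℝ) * Real.pi / n * i) * Real.sin ((j : ℝ) * Real.pi / n * k))) with hD
  have hg : gk n t i k = ∑ j ∈ Finset.Icc 1 (n - 1), D j := by
    apply Finset.sum_congr rfl
    intro j _
    simp only [phiF, hD]
    have h2 : Real.sqrt 2 * Real.sqrt 2 = 2 := Real.mul_self_sqrt (by norm_num)
    have a1 : (j : ℝ) * Real.pi * (i / n) = (j : ℝ) * Real.pi / n * i := by ring
    have a2 : (j : ℝ) * Real.pi * (k / n) = (j : ℝ) * Real.pi / n * k := by ring
    rw [a1, a2]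
    linear_combination (Real.exp (lamn n j * t) *
    ((Real.sin ((j : ℝ) * Real.pi / n * i) * Real.sin ((j : ℝ) * Real.pi / n * k)))) * h2
  have hK : Kp n t (i + (-1) * k) - Kp n t (i + 1 * k) = ∑ j ∈ Finset.range (2 * n), D j := by
    rw [Kp, Kp, ← Finset.sum_sub_distrib]
    apply Finset.sum_congr rfl
    intro j _
    simp only [hD]
    push_cast
    have a1 : (j : ℝ) * Real.pi / n * (i + -1 * k) = (j : ℝ) * Real.pi / n * i - (j : ℝ) * Real.pi / n * k := by ring
    have a2 : (j : ℝ) * Real.pi / n * (i + 1 * k) = (j : ℝ) * Real.pi / n * i + (j : ℝ) * Real.pi / n * k := by ring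
    rw [a1, a2, Real.cos_sub, Real.cos_add]; ring
  rw [hg, hK]
  have D0 : D 0 = 0 := by simp [hD]
  have Dn : D n = 0 := by
    simp only [hD]
    have : (n : ℝ) * Real.pi / n * i = i * Real.pi := by field_simp
    rw [this, Real.sin_int_mul_pi]; ring
  have Dr : ∀ j : ℕ, j ≤ 2 * n → D (2 * n - j) = D j := by
    intro j hj
    simp only [hD]
    have c : ((2 * n - j : ℕ) : ℝ) = 2 * n - j := by rw [Nat.cast_sub hj]; push_cast; ring
    have e : lamn n (2 * n - j) = lamn n j := by
      simp only [lamn]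
      rw [c]
      have : (2 * (n : ℝ) - j) * Real.pi / (2 * n) = Real.pi - j * Real.pi / (2 * n) := by field_simp
      rw [this, Real.sin_pi_sub]
    have f : ∀ l : ℤ, Real.sin (((2 * n - j : ℕ) : ℝ) * Real.pi / n * l) = -Real.sin ((j : ℝ) * Real.pi / n * l) := by
      intro l
      rw [c]
      have : (2 * (n : ℝ) - j) * Real.pi / n * l = -((j : ℝ) * Real.pi / n * l) + l * (2 * Real.pi) := by
        field_simp; ring
      rw [this, Real.sin_add_int_mul_two_pi, Real.sin_neg]
    rw [e, f, f]; ring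
  obtain ⟨m, rfl⟩ : ∃ m, n = m + 1 := ⟨n - 1, by omega⟩
  have s1 : ∑ j ∈ Finset.Icc 1 (m + 1 - 1), D j = ∑ j ∈ Finset.range m, D (j + 1) := by
    rw [Nat.add_sub_cancel, ← Finset.Ico_add_one_right_eq_Icc, Finset.sum_Ico_eq_sum_range]
    simp [add_comm]
  have s2 : ∑ j ∈ Finset.range (2 * (m + 1)), D j = 2 * ∑ j ∈ Finset.range m, D (j + 1) := by
    rw [two_mul (m + 1), Finset.sum_range_add, Finset.sum_range_succ', D0,
      Finset.sum_range_succ', add_zero (m + 1), Dn, ← Finset.sum_range_reflect (fun j => D (m + 1 + (j + 1)))]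
    have : ∑ j ∈ Finset.range m, D (m + 1 + (m - 1 - j + 1)) = ∑ j ∈ Finset.range m, D (j + 1) := by
      apply Finset.sum_congr rfl
      intro j hj
      have := Finset.mem_range.mp hj
      rw [← Dr (j + 1) (by omega)]
      congr 1; omega
    rw [this]; ring
  rw [s1, s2]; ring

lemma gk_l1 (n : ℕ) (hn : 0 < n) (t : ℝ) (ht : 0 ≤ t) (i : ℤ) :
    ∑ k ∈ Finset.range n, |gk n t i k| ≤ 2 * n := by
  calc ∑ k ∈ Finset.range n, |gk n t i k|
      ≤ ∑ k ∈ Finset.range (2 * n), |gk n t i k| :=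
        Finset.sum_le_sum_of_subset_of_nonneg (Finset.range_subset_range.mpr (by omega)) (fun _ _ _ => abs_nonneg _)
    _ ≤ ∑ k ∈ Finset.range (2 * n), ((Kp n t (i + (-1) * k) + Kp n t (i + 1 * k)) / 2) := by
        apply Finset.sum_le_sum
        intro k _
        rw [gk_eq n hn]
        have h1 := Kp_nonneg n hn t ht (i + (-1) * k)
        have h2 := Kp_nonneg n hn t ht (i + 1 * k)
        rw [abs_le]; constructor <;> linarith
    _ = 2 * n := by
        rw [← Finset.sum_div, Finset.sum_add_distrib, Kp_sum n hn t i (-1) (by simp), Kp_sum n hn t i 1 (by simp)]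
        ring

lemma Gn_eq (n : ℕ) (t x y : ℝ) : Gn n t x y =
    (1 - ((n : ℝ) * x - ⌊(n : ℝ) * x⌋)) * gk n t ⌊(n : ℝ) * x⌋ ⌊(n : ℝ) * y⌋
    + ((n : ℝ) * x - ⌊(n : ℝ) * x⌋) * gk n t (⌊(n : ℝ) * x⌋ + 1) ⌊(n : ℝ) * y⌋ := by
  rw [Gn, gk, gk, Finset.mul_sum, Finset.mul_sum, ← Finset.sum_add_distrib]
  apply Finset.sum_congr rfl
  intro j _
  simp only [phiLin, kappa]
  push_cast
  ring

/-- cell values -/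
noncomputable def gc (n : ℕ) (t x : ℝ) (k : ℤ) : ℝ :=
    (1 - ((n : ℝ) * x - ⌊(n : ℝ) * x⌋)) * gk n t ⌊(n : ℝ) * x⌋ k
    + ((n : ℝ) * x - ⌊(n : ℝ) * x⌋) * gk n t (⌊(n : ℝ) * x⌋ + 1) k

lemma gk_exp (n : ℕ) (hn : 0 < n) (t : ℝ) (ht : 1 ≤ t) (i k : ℤ) :
    |gk n t i k| ≤ 4 * Real.exp (-4 * t) := by
  have hn' : (0 : ℝ) < n := by positivity
  have hr : Real.exp (-4) ≤ 1 / 2 := by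
    have h := Real.add_one_le_exp (4 : ℝ)
    rw [Real.exp_neg, inv_le_comm₀ (Real.exp_pos _) (by norm_num)]
    norm_num; linarith
  have hφ : ∀ (j : ℕ) (z : ℝ), |phiF j z| ≤ Real.sqrt 2 := by
    intro j z
    rw [phiF, abs_mul, abs_of_nonneg (Real.sqrt_nonneg _)]
    exact mul_le_of_le_one_right (Real.sqrt_nonneg _) (Real.abs_sin_le_one _)
  have hterm : ∀ j ∈ Finset.Icc 1 (n - 1), |Real.exp (lamn n j * t) * phiF j ((i : ℝ) / n) * phiF j ((k : ℝ) / n)|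
      ≤ 2 * Real.exp (-4 * t) * (1 / 2) ^ (j - 1) := by
    intro j hj
    obtain ⟨hj1, hj2⟩ := Finset.mem_Icc.mp hj
    have hjn : (j : ℝ) ≤ n := by exact_mod_cast (by omega : j ≤ n)
    have hj1' : (1 : ℝ) ≤ j := by exact_mod_cast hj1
    have hs : (j : ℝ) / n ≤ Real.sin ((j : ℝ) * Real.pi / (2 * n)) := by
      have := Real.mul_le_sin (x := (j : ℝ) * Real.pi / (2 * n)) (by positivity) (by
        rw [div_le_div_iff₀ (by positivity) (by norm_num)]
        nlinarith [Real.pi_pos])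
      refine le_trans (le_of_eq ?_) this
      field_simp
    have hl : lamn n j ≤ -4 * j := by
      have h1 : ((j : ℝ) / n) ^ 2 ≤ Real.sin ((j : ℝ) * Real.pi / (2 * n)) ^ 2 :=
        pow_le_pow_left₀ (by positivity) hs 2
      have h2 : (n : ℝ) ^ 2 * ((j : ℝ) / n) ^ 2 = j ^ 2 := by field_simp
      have h3 := mul_le_mul_of_nonneg_left h1 (by positivity : (0 : ℝ) ≤ (n : ℝ) ^ 2)
      rw [lamn]
      nlinarith
    have he : Real.exp (lamn n j * t) ≤ Real.exp (-4 * t) * (1 / 2) ^ (j - 1) := by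
      calc Real.exp (lamn n j * t) ≤ Real.exp (-4 * t + ((j - 1 : ℕ) : ℝ) * (-4)) := by
            apply Real.exp_le_exp.mpr
            rw [Nat.cast_sub hj1]; push_cast
            nlinarith [mul_le_mul_of_nonneg_right hl (by linarith : (0 : ℝ) ≤ t), mul_nonneg (sub_nonneg.mpr hj1') (sub_nonneg.mpr ht)]
        _ = Real.exp (-4 * t) * Real.exp (-4) ^ (j - 1) := by rw [Real.exp_add, Real.exp_nat_mul]
        _ ≤ _ := by gcongr
    rw [abs_mul, abs_mul, abs_of_pos (Real.exp_pos _)]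
    calc _ ≤ Real.exp (-4 * t) * (1 / 2) ^ (j - 1) * Real.sqrt 2 * Real.sqrt 2 := by
          gcongr
          · exact hφ _ _
          · exact hφ _ _
      _ = _ := by rw [mul_assoc, Real.mul_self_sqrt (by norm_num)]; ring
  calc |gk n t i k| ≤ ∑ j ∈ Finset.Icc 1 (n - 1), 2 * Real.exp (-4 * t) * (1 / 2) ^ (j - 1) :=
        (Finset.abs_sum_le_sum_abs _ _).trans (Finset.sum_le_sum hterm)
    _ = 2 * Real.exp (-4 * t) * ∑ j ∈ Finset.range (n - 1), (1 / 2 : ℝ) ^ j := by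
        rw [← Finset.mul_sum, ← Finset.Ico_add_one_right_eq_Icc, Finset.sum_Ico_eq_sum_range]
        simp
    _ ≤ 2 * Real.exp (-4 * t) * 2 := by
        gcongr
        exact sum_geometric_two_le _
    _ = _ := by ring

lemma gk_l1' (n : ℕ) (hn : 0 < n) (t : ℝ) (ht : 0 < t) (i : ℤ) :
    ∑ k ∈ Finset.range n, |gk n t i k| ≤ 4 * Real.exp 4 * Real.exp (-4 * t) * n := by
  have hn' : (0 : ℝ) < n := by positivity
  rcases le_total t 1 with h | h
  · refine (gk_l1 n hn t ht.le i).trans ?_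
    gcongr
    rw [mul_assoc, ← Real.exp_add]
    have := Real.one_le_exp (x := 4 + -4 * t) (by linarith)
    linarith
  · calc _ ≤ ∑ k ∈ Finset.range n, 4 * Real.exp (-4 * t) := Finset.sum_le_sum (fun k _ => gk_exp n hn t h i k)
      _ = 4 * 1 * Real.exp (-4 * t) * n := by simp; ring
      _ ≤ _ := by
        gcongr
        exact Real.one_le_exp (by norm_num)

lemma gc_l1 (n : ℕ) (hn : 0 < n) (t x : ℝ) (ht : 0 < t) :
    ∑ k ∈ Finset.range n, |gc n t x k| ≤ 4 * Real.exp 4 * Real.exp (-4 * t) * n := by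
  have h0 : 0 ≤ (n : ℝ) * x - ⌊(n : ℝ) * x⌋ := sub_nonneg.mpr (Int.floor_le _)
  have h1 : 0 ≤ 1 - ((n : ℝ) * x - ⌊(n : ℝ) * x⌋) := by linarith [Int.lt_floor_add_one ((n : ℝ) * x)]
  have a := gk_l1' n hn t ht ⌊(n : ℝ) * x⌋
  have b := gk_l1' n hn t ht (⌊(n : ℝ) * x⌋ + 1)
  calc ∑ k ∈ Finset.range n, |gc n t x k| ≤ ∑ k ∈ Finset.range n,
      ((1 - ((n : ℝ) * x - ⌊(n : ℝ) * x⌋)) * |gk n t ⌊(n : ℝ) * x⌋ k| +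
        ((n : ℝ) * x - ⌊(n : ℝ) * x⌋) * |gk n t (⌊(n : ℝ) * x⌋ + 1) k|) := by
        apply Finset.sum_le_sum
        intro k _
        refine (abs_add_le _ _).trans (le_of_eq ?_)
        rw [abs_mul, abs_mul, abs_of_nonneg h0, abs_of_nonneg h1]
    _ ≤ _ := by
        rw [Finset.sum_add_distrib, ← Finset.mul_sum, ← Finset.mul_sum]
        nlinarith [mul_le_mul_of_nonneg_left a h1, mul_le_mul_of_nonneg_left b h0]

lemma absrpow_ii (β : ℝ) (hβ : β < 1) (a b : ℝ) :
    IntervalIntegrable (fun u : ℝ => |u| ^ (-β)) volume a b := by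
  have pos : ∀ c : ℝ, 0 ≤ c → IntervalIntegrable (fun u : ℝ => |u| ^ (-β)) volume 0 c := by
    intro c hc
    have h := intervalIntegral.intervalIntegrable_rpow' (a := 0) (b := c) (r := -β) (by linarith)
    refine h.congr ?_
    intro u hu
    rw [Set.uIoc_of_le hc] at hu
    simp only [abs_of_pos hu.1]
  have all : ∀ c : ℝ, IntervalIntegrable (fun u : ℝ => |u| ^ (-β)) volume 0 c := by
    intro c
    rcases le_total 0 c with h | h
    · exact pos c h
    · have := pos (-c) (by linarith)
      have h2 := this.comp_sub_left 0
      simpa using h2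
  exact (all a).symm.trans (all b)

lemma absrpow_int (β : ℝ) (hβ0 : 0 ≤ β) (hβ : β < 1) (c h : ℝ) (hh : 0 < h) :
    ∫ u in c..(c + h), |u| ^ (-β) ≤ (1 + 2 / (1 - β)) * h ^ (1 - β) := by
  have hpos : ∫ u in (0 : ℝ)..h, |u| ^ (-β) = h ^ (1 - β) / (1 - β) := by
    rw [intervalIntegral.integral_congr (g := fun u : ℝ => u ^ (-β)) (by
      intro u hu
      rw [Set.uIcc_of_le hh.le] at hu
      simp only [abs_of_nonneg hu.1]), integral_rpow (Or.inl (by linarith))]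
    rw [show -β + 1 = 1 - β by ring, Real.zero_rpow (by linarith), sub_zero]
  have hneg : ∫ u in (-h)..(0 : ℝ), |u| ^ (-β) = h ^ (1 - β) / (1 - β) := by
    rw [← hpos]
    have := intervalIntegral.integral_comp_neg (a := 0) (b := h) (fun u : ℝ => |u| ^ (-β))
    simp only [abs_neg, neg_zero] at this
    exact this.symm
  have hfull : ∫ u in (-h)..h, |u| ^ (-β) = 2 * (h ^ (1 - β) / (1 - β)) := by
    rw [← intervalIntegral.integral_add_adjacent_intervals (absrpow_ii β hβ (-h) 0) (absrpow_ii β hβ 0 h),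
      hpos, hneg]; ring
  have hint : Integrable ((Set.Ioc (-h) h).indicator (fun u : ℝ => |u| ^ (-β))) := by
    rw [integrable_indicator_iff measurableSet_Ioc]
    exact (intervalIntegrable_iff_integrableOn_Ioc_of_le (by linarith)).mp (absrpow_ii β hβ (-h) h)
  have hind : ∀ u, 0 ≤ (Set.Ioc (-h) h).indicator (fun u : ℝ => |u| ^ (-β)) u :=
    fun u => Set.indicator_nonneg (fun _ _ => by positivity) u
  rw [intervalIntegral.integral_of_le (by linarith)]
  calc ∫ u in Set.Ioc c (c + h), |u| ^ (-β)
      ≤ ∫ u in Set.Ioc c (c + h), (h ^ (-β) + (Set.Ioc (-h) h).indicator (fun u : ℝ => |u| ^ (-β)) u) := by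
        apply integral_mono_of_nonneg
        · exact Filter.Eventually.of_forall fun u => by positivity
        · exact (integrable_const _).add hint.integrableOn
        · refine Filter.Eventually.of_forall fun u => ?_
          by_cases hu : u ∈ Set.Ioc (-h) h
          · simp only [Set.indicator_of_mem hu]
            have : 0 ≤ h ^ (-β) := by positivity
            linarith
          · simp only [Set.indicator_of_notMem hu, add_zero]
            apply Real.rpow_le_rpow_of_nonpos hh _ (by linarith)
            by_contra hc
            push Not at hc
            exact hu ⟨(abs_lt.mp hc).1, (abs_lt.mp hc).2.le⟩
    _ = h * h ^ (-β) + ∫ u in Set.Ioc c (c + h), (Set.Ioc (-h) h).indicator (fun u : ℝ => |u| ^ (-β)) u := by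
        rw [integral_add (integrable_const _) hint.integrableOn]
        simp [hh.le]
    _ ≤ h * h ^ (-β) + 2 * (h ^ (1 - β) / (1 - β)) := by
        gcongr
        refine (setIntegral_le_integral hint (Filter.Eventually.of_forall hind)).trans (le_of_eq ?_)
        rw [integral_indicator measurableSet_Ioc, ← intervalIntegral.integral_of_le (by linarith), hfull]
    _ = _ := by
        rw [show h * h ^ (-β) = h ^ (1 - β) by
          rw [sub_eq_add_neg, Real.rpow_add hh, Real.rpow_one]]
        ring

lemma ker_ii (β : ℝ) (hβ : β < 1) (y a b : ℝ) :
    IntervalIntegrable (fun z : ℝ => |y - z| ^ (-β)) volume a b := by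
  have := (absrpow_ii β hβ (y - a) (y - b)).comp_sub_left y
  simpa using this

lemma ker_int (β : ℝ) (hβ0 : 0 ≤ β) (hβ : β < 1) (y a h : ℝ) (hh : 0 < h) :
    ∫ z in a..(a + h), |y - z| ^ (-β) ≤ (1 + 2 / (1 - β)) * h ^ (1 - β) := by
  have := intervalIntegral.integral_comp_sub_left (a := a) (b := a + h) (fun u : ℝ => |u| ^ (-β)) y
  rw [this]
  have h2 := absrpow_int β hβ0 hβ (y - (a + h)) h hh
  convert h2 using 2
  ring

lemma oneD (β : ℝ) (hβ0 : 0 ≤ β) (hβ : β < 1) (n : ℕ) (hn : 0 < n) (t x y : ℝ) (ht : 0 < t) :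
    IntegrableOn (fun z => |Gn n t x z| * |y - z| ^ (-β)) (Set.Icc 0 1) ∧
    ∫ z in Set.Icc (0 : ℝ) 1, |Gn n t x z| * |y - z| ^ (-β) ≤
      (1 + 2 / (1 - β)) * (4 * Real.exp 4 * Real.exp (-4 * t)) * (n : ℝ) ^ β := by
  have hn' : (0 : ℝ) < n := by positivity
  set a : ℕ → ℝ := fun k => (k : ℝ) / n with ha
  have hstep : ∀ k, a (k + 1) = a k + 1 / n := by intro k; simp only [ha]; push_cast; ring
  have hle : ∀ k, a k ≤ a (k + 1) := by intro k; rw [hstep]; have : 0 < 1 / (n : ℝ) := by positivity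
                                        linarith
  have heq : ∀ k : ℕ, Set.EqOn (fun z => |gc n t x k| * |y - z| ^ (-β))
      (fun z => |Gn n t x z| * |y - z| ^ (-β)) (Set.uIoo (a k) (a (k + 1))) := by
    intro k z hz
    rw [Set.uIoo_of_le (hle k)] at hz
    have hf : ⌊(n : ℝ) * z⌋ = (k : ℤ) := by
      rw [Int.floor_eq_iff]
      have h1 := hz.1
      have h2 := hz.2
      simp only [ha] at h1 h2
      rw [div_lt_iff₀ hn'] at h1
      rw [lt_div_iff₀ hn'] at h2
      push_cast at h2 ⊢
      constructor <;> linarith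
    simp only [Gn_eq, hf, gc]
  have hii : ∀ k < n, IntervalIntegrable (fun z => |Gn n t x z| * |y - z| ^ (-β)) volume (a k) (a (k + 1)) := by
    intro k _
    exact ((ker_ii β hβ y _ _).const_mul _).congr_uIoo (heq k)
  have a0 : a 0 = 0 := by simp [ha]
  have an : a n = 1 := by simp [ha, hn'.ne']
  constructor
  · have := IntervalIntegrable.trans_iterate hii
    rw [a0, an] at this
    rw [integrableOn_Icc_iff_integrableOn_Ioc]
    exact (intervalIntegrable_iff_integrableOn_Ioc_of_le zero_le_one).mp this
  · have := intervalIntegral.sum_integral_adjacent_intervals hii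
    rw [a0, an] at this
    rw [integral_Icc_eq_integral_Ioc, ← intervalIntegral.integral_of_le zero_le_one, ← this]
    have hβ' : 0 < 1 - β := by linarith
    calc _ ≤ ∑ k ∈ Finset.range n, |gc n t x k| * ((1 + 2 / (1 - β)) * (1 / (n : ℝ)) ^ (1 - β)) := by
          apply Finset.sum_le_sum
          intro k _
          rw [← intervalIntegral.integral_congr_uIoo (heq k), intervalIntegral.integral_const_mul, hstep]
          gcongr
          exact ker_int β hβ0 hβ y _ _ (by positivity)
      _ ≤ (4 * Real.exp 4 * Real.exp (-4 * t) * n) * ((1 + 2 / (1 - β)) * (1 / (n : ℝ)) ^ (1 - β)) := by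
          rw [← Finset.sum_mul]
          gcongr
          exact gc_l1 n hn t x ht
      _ = _ := by
          have : (n : ℝ) * (1 / (n : ℝ)) ^ (1 - β) = (n : ℝ) ^ β := by
            rw [one_div, Real.inv_rpow hn'.le, ← Real.rpow_neg hn'.le]
            nth_rewrite 1 [← Real.rpow_one (n : ℝ)]
            rw [← Real.rpow_add hn']
            congr 1; ring
          rw [← this]; ring

lemma multiD (d : ℕ) (f : Fin d → ℝ → ℝ) (hf : ∀ i, IntegrableOn (f i) (Set.Icc 0 1)) :
    IntegrableOn (fun z : EuclideanSpace ℝ (Fin d) => ∏ i, f i (z i)) (Q d) ∧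
    ∫ z in Q d, ∏ i, f i (z i) = ∏ i, ∫ u in Set.Icc (0 : ℝ) 1, f i u := by
  have mp := PiLp.volume_preserving_toLp (Fin d)
  have me : MeasurableEmbedding (WithLp.toLp 2 : (Fin d → ℝ) → EuclideanSpace ℝ (Fin d)) :=
    (MeasurableEquiv.toLp 2 (Fin d → ℝ)).measurableEmbedding
  have hQ : (WithLp.toLp 2 : (Fin d → ℝ) → EuclideanSpace ℝ (Fin d)) ⁻¹' (Q d) =
      Set.univ.pi (fun _ => Set.Icc (0 : ℝ) 1) := by
    ext z; simp only [Q, Set.mem_preimage, Set.mem_setOf_eq, Set.mem_pi, Set.mem_univ, true_imp_iff]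
  constructor
  · rw [← mp.integrableOn_comp_preimage me, hQ, IntegrableOn, volume_pi, Measure.restrict_pi_pi]
    exact Integrable.fintype_prod (f := f) hf
  · rw [← mp.setIntegral_preimage_emb me, hQ, volume_pi, Measure.restrict_pi_pi]
    exact integral_fintype_prod_eq_prod (fun i u => f i u)

lemma hyper (d : ℕ) (y : EuclideanSpace ℝ (Fin d)) :
    ∀ᵐ z : EuclideanSpace ℝ (Fin d), ∀ i, z i ≠ y i := by
  rw [ae_all_iff]
  intro i
  have mp := PiLp.volume_preserving_toLp (Fin d)
  have me : MeasurableEmbedding (WithLp.toLp 2 : (Fin d → ℝ) → EuclideanSpace ℝ (Fin d)) :=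
    (MeasurableEquiv.toLp 2 (Fin d → ℝ)).measurableEmbedding
  rw [ae_iff, ← mp.measure_preimage_emb me]
  have := Measure.pi_hyperplane (fun _ : Fin d => (volume : Measure ℝ)) i (y i)
  simpa [volume_pi] using this

/-- `sup_{x∈Q} ‖(G_d)^n(t,x,·)‖_{(α)}² ≤ C n^α e^{-ct}`. -/
theorem stmt_10 (d : ℕ) (hd : 1 ≤ d) (α : ℝ) (hα : α ∈ Set.Ioo (0 : ℝ) (min 2 (d : ℝ))) :
    ∃ c C : ℝ, 0 < c ∧ 0 < C ∧ ∀ n : ℕ, 2 ≤ n → ∀ t : ℝ, 0 < t → ∀ x ∈ Q d,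
      normAlphaSq d α (fun y => Gdn d n t x y) ≤ C * (n : ℝ) ^ α * Real.exp (-c * t) := by
  have hd' : (0 : ℝ) < d := by exact_mod_cast hd
  have hα0 : 0 < α := hα.1
  have hαd : α < d := lt_of_lt_of_le hα.2 (min_le_right _ _)
  set β : ℝ := α / d with hβd
  have hβ0 : 0 < β := by positivity
  have hβ : β < 1 := by rw [hβd, div_lt_one hd']; exact hαd
  have hβ' : 0 < 1 - β := by linarith
  have hβα : β * d = α := by rw [hβd]; field_simp
  set M : ℝ := 4 * Real.exp 4 with hM
  set B : ℝ := 1 + 2 / (1 - β) with hB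
  have hMp : 0 < M := by positivity
  have hBp : 0 < B := by positivity
  refine ⟨8 * d, (B * M) ^ d * (3 * M) ^ d, by positivity, by positivity, ?_⟩
  intro n hn t ht x _
  have hn0 : 0 < n := by omega
  have hn' : (0 : ℝ) < n := by positivity
  -- inner bound
  have inner : ∀ y : EuclideanSpace ℝ (Fin d),
      ∫ z in Q d, |Gdn d n t x y| * ‖y - z‖ ^ (-α) * |Gdn d n t x z| ≤
        |Gdn d n t x y| * (B * (M * Real.exp (-4 * t)) * (n : ℝ) ^ β) ^ d := by
    intro y
    have h1 := fun i => oneD β hβ0.le hβ n hn0 t (x i) (y i) ht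
    obtain ⟨mi, me⟩ := multiD d (fun i u => |Gn n t (x i) u| * |y i - u| ^ (-β)) (fun i => (h1 i).1)
    calc _ = |Gdn d n t x y| * ∫ z in Q d, ‖y - z‖ ^ (-α) * |Gdn d n t x z| := by
          rw [← integral_const_mul]; simp only [mul_assoc]
      _ ≤ |Gdn d n t x y| * ∫ z in Q d, ∏ i, (|Gn n t (x i) (z i)| * |y i - z i| ^ (-β)) := by
          refine mul_le_mul_of_nonneg_left ?_ (abs_nonneg _)
          apply integral_mono_of_nonneg
          · exact Filter.Eventually.of_forall fun z => by positivity
          · exact mi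
          · filter_upwards [ae_restrict_of_ae (hyper d y)] with z hz
            rw [Finset.prod_mul_distrib, Gdn, Finset.abs_prod, mul_comm]
            gcongr
            have hdpos : 0 < ‖y - z‖ := by
              rw [norm_pos_iff, sub_ne_zero]
              rintro rfl
              exact hz ⟨0, hd⟩ rfl
            calc ‖y - z‖ ^ (-α) = ∏ i : Fin d, ‖y - z‖ ^ (-β) := by
                  rw [Finset.prod_const, Finset.card_univ, Fintype.card_fin, ← Real.rpow_natCast,
                    ← Real.rpow_mul hdpos.le]
                  congr 1; rw [← hβα]; ring
              _ ≤ _ := by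
                  apply Finset.prod_le_prod
                  · intro i _; positivity
                  · intro i _
                    apply Real.rpow_le_rpow_of_nonpos _ _ (by linarith)
                    · exact abs_pos.mpr (sub_ne_zero.mpr (hz i).symm)
                    · have := PiLp.norm_apply_le (y - z) i
                      simpa using this
      _ ≤ _ := by
          rw [me]
          gcongr
          calc _ ≤ ∏ i : Fin d, (B * (M * Real.exp (-4 * t)) * (n : ℝ) ^ β) := by
                apply Finset.prod_le_prod
                · intro i _; exact integral_nonneg fun z => by positivity
                · intro i _; exact (h1 i).2
            _ = _ := by simp
  have h0 := fun i => oneD 0 le_rfl zero_lt_one n hn0 t (x i) 0 ht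
  obtain ⟨mi, me⟩ := multiD d (fun i u => |Gn n t (x i) u| * |0 - u| ^ (-(0 : ℝ))) (fun i => (h0 i).1)
  have hprod : (fun z : EuclideanSpace ℝ (Fin d) => ∏ i, (|Gn n t (x i) (z i)| * |0 - z i| ^ (-(0 : ℝ)))) =
      fun z => |Gdn d n t x z| := by
    funext z
    rw [Gdn, Finset.abs_prod]; simp
  rw [hprod] at mi me
  have outer : ∫ z in Q d, |Gdn d n t x z| ≤ (3 * (M * Real.exp (-4 * t))) ^ d := by
    rw [me]
    calc _ ≤ ∏ i : Fin d, (3 * (M * Real.exp (-4 * t))) := by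
          apply Finset.prod_le_prod
          · intro i _; exact integral_nonneg fun z => by positivity
          · intro i _
            refine (h0 i).2.trans (le_of_eq ?_)
            rw [Real.rpow_zero, hM]; norm_num
      _ = _ := by simp
  rw [normAlphaSq]
  calc _ ≤ ∫ y in Q d, |Gdn d n t x y| * (B * (M * Real.exp (-4 * t)) * (n : ℝ) ^ β) ^ d := by
        apply integral_mono_of_nonneg
        · exact Filter.Eventually.of_forall fun y => integral_nonneg fun z => by positivity
        · exact mi.mul_const _
        · exact Filter.Eventually.of_forall inner
    _ ≤ (3 * (M * Real.exp (-4 * t))) ^ d * (B * (M * Real.exp (-4 * t)) * (n : ℝ) ^ β) ^ d := by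
        rw [integral_mul_const]
        gcongr
    _ = _ := by
        have e1 : ((n : ℝ) ^ β) ^ d = (n : ℝ) ^ α := by
          rw [← Real.rpow_natCast, ← Real.rpow_mul hn'.le, hβα]
        have e2 : Real.exp (-(8 * (d : ℝ)) * t) = Real.exp (-4 * t) ^ d * Real.exp (-4 * t) ^ d := by
          rw [← Real.exp_nat_mul, ← Real.exp_add]; congr 1; ring
        rw [e2, ← e1]
        simp only [mul_pow]
        ring
end

section
/- Let $d\ge 1$, $T>0$ and $\lambda\in(0,1/2)$. There exist constants $c>0$ and $C>0$ such that for all integers $n\ge 2$, $m\ge 1$ and all $t\in(0,T]$: $\sup_{x\in Q}\int_Q |(G_d)^{n,m}(t,x,y)|\, dy \le C\, e^{-ct}\,\bigl(1+t^{-\lambda}\bigr)$. -/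
open MeasureTheory

/-- Implicit space-time discretized Green function
`(G_d)^{n,m}(t,x,y) = ∑_{k ∈ {1,…,n-1}^d} (1 - (T/m) λ_k^n)^{-⌊mt/T⌋} φ_k^n(x) φ_k(κ_n(y))`. -/
noncomputable def Gdnm (d : ℕ) (T : ℝ) (n m : ℕ) (t : ℝ)
    (x y : EuclideanSpace ℝ (Fin d)) : ℝ :=
  ∑ k ∈ Finset.Icc (fun _ : Fin d => 1) (fun _ : Fin d => n - 1),
    (1 - T / (m : ℝ) * ∑ i, lamn n (k i)) ^ (-⌊(m : ℝ) * t / T⌋) *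
      (∏ i, phiLin n (k i) (x i)) * ∏ i, phiF (k i) (kappa n (y i))


/-- One-dimensional discrete orthogonality kernel. -/
noncomputable def Kker (n : ℕ) (a b : ℤ) : ℝ :=
  ∑ j ∈ Finset.Icc 1 (n - 1), phiF j ((a : ℝ) / n) * phiF j ((b : ℝ) / n)

lemma aux_cos_sum (n : ℕ) (hn : 2 ≤ n) (c : ℤ) :
    ∑ j ∈ Finset.Icc 1 (n - 1), Real.cos ((j : ℝ) * Real.pi * c / n) =
      -(1 + (-1 : ℝ) ^ c) / 2 + if (2 * (n : ℤ)) ∣ c then (n : ℝ) else 0 := by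
  have hn0 : (n : ℝ) ≠ 0 := by positivity
  split_ifs with h
  · obtain ⟨q, rfl⟩ := h
    have h1 : ∀ j ∈ Finset.Icc 1 (n - 1),
        Real.cos ((j : ℝ) * Real.pi * ((2 * (n : ℤ) * q : ℤ) : ℝ) / n) = 1 := by
      intro j _
      have : (j : ℝ) * Real.pi * ((2 * (n : ℤ) * q : ℤ) : ℝ) / n = ((j * q : ℤ) : ℝ) * (2 * Real.pi) := by
        push_cast; field_simp
      rw [this, Real.cos_int_mul_two_pi]
    rw [Finset.sum_congr rfl h1]
    have h2 : (-1 : ℝ) ^ (2 * (n : ℤ) * q) = 1 := by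
      rw [mul_assoc, zpow_mul]; simp
    rw [h2]
    simp only [Finset.sum_const, Nat.card_Icc, nsmul_eq_mul, mul_one]
    rw [show n - 1 + 1 - 1 = n - 1 by omega, Nat.cast_sub (by omega)]
    push_cast; ring
  · set θ : ℝ := Real.pi * c / n with hθ
    have hs : Real.sin (θ / 2) ≠ 0 := by
      intro h0
      rw [Real.sin_eq_zero_iff] at h0
      obtain ⟨q, hq⟩ := h0
      apply h
      refine ⟨q, ?_⟩
      have hpi := Real.pi_ne_zero
      have : (c : ℝ) = 2 * n * q := by
        rw [hθ] at hq
        field_simp at hq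
        linarith
      exact_mod_cast this
    have tele : ∀ N : ℕ, 2 * Real.sin (θ / 2) * ∑ j ∈ Finset.Icc 1 N, Real.cos ((j : ℝ) * θ)
        = Real.sin ((N : ℝ) * θ + θ / 2) - Real.sin (θ / 2) := by
      intro N
      induction N with
      | zero => simp
      | succ N ih =>
        rw [Finset.sum_Icc_succ_top (by omega), mul_add, ih]
        have e1 : Real.sin (((N + 1 : ℕ) : ℝ) * θ + θ / 2) =
            Real.sin (((N + 1 : ℕ) : ℝ) * θ) * Real.cos (θ / 2)
              + Real.cos (((N + 1 : ℕ) : ℝ) * θ) * Real.sin (θ / 2) := Real.sin_add _ _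
        have e2 : Real.sin ((N : ℝ) * θ + θ / 2) =
            Real.sin (((N + 1 : ℕ) : ℝ) * θ) * Real.cos (θ / 2)
              - Real.cos (((N + 1 : ℕ) : ℝ) * θ) * Real.sin (θ / 2) := by
          rw [← Real.sin_sub]; congr 1; push_cast; ring
        rw [e1, e2]; ring
    have e3 : Real.sin (((n - 1 : ℕ) : ℝ) * θ + θ / 2) = -((-1 : ℝ) ^ c * Real.sin (θ / 2)) := by
      have : ((n - 1 : ℕ) : ℝ) * θ + θ / 2 = (c : ℝ) * Real.pi - θ / 2 := by
        rw [Nat.cast_sub (by omega), hθ]; push_cast; field_simp; ring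
      rw [this, Real.sin_int_mul_pi_sub]
    have h4 := tele (n - 1)
    rw [e3] at h4
    have h5 : ∑ j ∈ Finset.Icc 1 (n - 1), Real.cos ((j : ℝ) * Real.pi * c / n)
        = ∑ j ∈ Finset.Icc 1 (n - 1), Real.cos ((j : ℝ) * θ) := by
      apply Finset.sum_congr rfl; intro j _; rw [hθ]; congr 1; ring
    rw [h5, add_zero]
    apply mul_left_cancel₀ (mul_ne_zero two_ne_zero hs)
    rw [h4]; ring

lemma aux_K (n : ℕ) (hn : 2 ≤ n) (a b : ℤ) :
    Kker n a b = (if (2 * (n : ℤ)) ∣ (a - b) then (n : ℝ) else 0)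
      - (if (2 * (n : ℤ)) ∣ (a + b) then (n : ℝ) else 0) := by
  have h1 : Kker n a b = ∑ j ∈ Finset.Icc 1 (n - 1), Real.cos ((j : ℝ) * Real.pi * ((a - b : ℤ) : ℝ) / n)
      - ∑ j ∈ Finset.Icc 1 (n - 1), Real.cos ((j : ℝ) * Real.pi * ((a + b : ℤ) : ℝ) / n) := by
    rw [Kker, ← Finset.sum_sub_distrib]
    apply Finset.sum_congr rfl
    intro j _
    have e1 : (j : ℝ) * Real.pi * ((a - b : ℤ) : ℝ) / n =
      (j : ℝ) * Real.pi * ((a : ℝ) / n) - (j : ℝ) * Real.pi * ((b : ℝ) / n) := by push_cast; ring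
    have e2 : (j : ℝ) * Real.pi * ((a + b : ℤ) : ℝ) / n =
      (j : ℝ) * Real.pi * ((a : ℝ) / n) + (j : ℝ) * Real.pi * ((b : ℝ) / n) := by push_cast; ring
    rw [e1, e2, Real.cos_sub, Real.cos_add, phiF, phiF]
    have : Real.sqrt 2 * Real.sqrt 2 = 2 := Real.mul_self_sqrt (by norm_num)
    linear_combination (Real.sin ((j : ℝ) * Real.pi * ((a : ℝ) / n)) *
      Real.sin ((j : ℝ) * Real.pi * ((b : ℝ) / n))) * this
  rw [h1, aux_cos_sum n hn, aux_cos_sum n hn]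
  have : (-1 : ℝ) ^ (a + b) = (-1 : ℝ) ^ (a - b) := by
    rw [show a + b = (a - b) + 2 * b by ring, zpow_add₀ (by norm_num), zpow_mul]; simp
  rw [this]; ring

lemma aux_K_sum (n : ℕ) (hn : 2 ≤ n) (a : ℤ) :
    ∑ b ∈ Finset.Icc (0 : ℤ) n, |Kker n a b| ≤ n := by
  have hN : (0 : ℤ) < 2 * n := by positivity
  set r := a % (2 * n) with hr
  have hr0 : 0 ≤ r := Int.emod_nonneg _ hN.ne'
  have hr1 : r < 2 * n := Int.emod_lt_of_pos _ hN
  have har : a = r + 2 * n * (a / (2 * n)) := (Int.emod_add_mul_ediv a (2 * n)).symm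
  have dsub : ∀ b : ℤ, (2 * (n : ℤ)) ∣ (a - b) ↔ (2 * (n : ℤ)) ∣ (r - b) := by
    intro b
    rw [show a - b = (r - b) + 2 * n * (a / (2 * n)) by linarith]
    exact Int.dvd_add_left (Dvd.intro _ rfl)
  have dadd : ∀ b : ℤ, (2 * (n : ℤ)) ∣ (a + b) ↔ (2 * (n : ℤ)) ∣ (r + b) := by
    intro b
    rw [show a + b = (r + b) + 2 * n * (a / (2 * n)) by linarith]
    exact Int.dvd_add_left (Dvd.intro _ rfl)
  have key : ∀ b0 : ℤ, (r = b0 ∨ r = 2 * n - b0) → 0 ≤ b0 → b0 ≤ n → ∀ b ∈ Finset.Icc (0 : ℤ) n,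
      |Kker n a b| ≤ if b = b0 then (n : ℝ) else 0 := by
    intro b0 hb0 h0 h1 b hb
    rw [Finset.mem_Icc] at hb
    have i1 : (2 * (n : ℤ)) ∣ (a - b) ↔ r = b := by
      rw [dsub]
      constructor
      · rintro ⟨q, hq⟩
        have hq1 : q < 1 := by nlinarith
        have hq2 : -1 < q := by nlinarith
        have : q = 0 := by omega
        subst this
        omega
      · rintro h
        exact ⟨0, by omega⟩
    have i2 : (2 * (n : ℤ)) ∣ (a + b) ↔ (r + b = 0 ∨ r + b = 2 * n) := by
      rw [dadd]
      constructor
      · rintro ⟨q, hq⟩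
        have hq1 : q < 2 := by nlinarith
        have hq2 : -1 < q := by nlinarith
        have : q = 0 ∨ q = 1 := by omega
        rcases this with h | h <;> subst h <;> omega
      · rintro (h | h)
        · exact ⟨0, by omega⟩
        · exact ⟨1, by omega⟩
    rw [aux_K n hn]
    simp only [i1, i2]
    split_ifs
    all_goals first
      | omega
      | simp
  have fin : ∀ b0 : ℤ, (r = b0 ∨ r = 2 * n - b0) → 0 ≤ b0 → b0 ≤ n →
      ∑ b ∈ Finset.Icc (0 : ℤ) n, |Kker n a b| ≤ n := by
    intro b0 hb0 h0 h1
    refine (Finset.sum_le_sum (key b0 hb0 h0 h1)).trans ?_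
    rw [Finset.sum_ite_eq']
    split_ifs
    · exact le_rfl
    · positivity
  by_cases h : r ≤ n
  · exact fin r (Or.inl rfl) hr0 h
  · exact fin (2 * n - r) (Or.inr (by ring)) (by omega) (by omega)

/-- Tensor product eigenfunction on the lattice. -/
noncomputable def PhiL (d n : ℕ) (k : Fin d → ℕ) (a : Fin d → ℤ) : ℝ :=
  ∏ i, phiF (k i) ((a i : ℝ) / n)

lemma aux_maxprin (d : ℕ) (f g : (Fin d → ℤ) → ℝ) (B p : ℝ) (hp : 0 ≤ p)
    (hB : ∀ a, |f a| ≤ B) (hg : ∀ a, |g a| ≤ 1)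
    (heq : ∀ a, f a + p * ∑ i, (2 * f a - f (Function.update a i (a i + 1))
      - f (Function.update a i (a i - 1))) = g a) (a : Fin d → ℤ) : |f a| ≤ 1 := by
  have hbdd : BddAbove (Set.range fun a => |f a|) := ⟨B, by rintro _ ⟨a, rfl⟩; exact hB a⟩
  set S := ⨆ a, |f a| with hS
  have hle : ∀ a, |f a| ≤ S := fun a => le_ciSup hbdd a
  have h1 : ∀ a, (1 + 2 * d * p) * |f a| ≤ 1 + 2 * d * p * S := by
    intro a
    have e : (1 + 2 * d * p) * f a = g a + p * ∑ i, (f (Function.update a i (a i + 1))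
      + f (Function.update a i (a i - 1))) := by
      have h := heq a
      have : ∑ i, (2 * f a - f (Function.update a i (a i + 1)) - f (Function.update a i (a i - 1)))
          = d * (2 * f a) - ∑ i, (f (Function.update a i (a i + 1))
            + f (Function.update a i (a i - 1))) := by
        simp only [sub_sub, Finset.sum_sub_distrib]
        simp
      rw [this] at h
      linear_combination h
    have e2 : |∑ i, (f (Function.update a i (a i + 1)) + f (Function.update a i (a i - 1)))|
        ≤ d * (2 * S) := by
      refine (Finset.abs_sum_le_sum_abs _ _).trans ?_
      refine (Finset.sum_le_card_nsmul _ _ (2 * S) ?_).trans ?_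
      · intro i _
        refine (abs_add_le _ _).trans ?_
        linarith [hle (Function.update a i (a i + 1)), hle (Function.update a i (a i - 1))]
      · simp
    have hpos : 0 ≤ 1 + 2 * d * p := by positivity
    calc (1 + 2 * d * p) * |f a| = |(1 + 2 * d * p) * f a| := by
          rw [abs_mul, abs_of_nonneg hpos]
      _ ≤ |g a| + |p * ∑ i, (f (Function.update a i (a i + 1))
            + f (Function.update a i (a i - 1)))| := by rw [e]; exact abs_add_le _ _
      _ ≤ 1 + p * (d * (2 * S)) := by
          rw [abs_mul, abs_of_nonneg hp]
          exact add_le_add (hg a) (mul_le_mul_of_nonneg_left e2 hp)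
      _ = _ := by ring
  have hpos : 0 < 1 + 2 * d * p := by positivity
  have h2 : S ≤ (1 + 2 * d * p * S) / (1 + 2 * d * p) := by
    apply ciSup_le
    intro a
    rw [le_div_iff₀ hpos]
    linarith [h1 a]
  rw [le_div_iff₀ hpos] at h2
  linarith [hle a]

lemma aux_eig1 (n j : ℕ) (hn : 2 ≤ n) (a : ℤ) :
    (n : ℝ) ^ 2 * (2 * phiF j ((a : ℝ) / n) - phiF j (((a + 1 : ℤ) : ℝ) / n)
      - phiF j (((a - 1 : ℤ) : ℝ) / n)) = - lamn n j * phiF j ((a : ℝ) / n) := by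
  have hn0 : (n : ℝ) ≠ 0 := by positivity
  unfold phiF lamn
  have e1 : (j : ℝ) * Real.pi * (((a + 1 : ℤ) : ℝ) / n) =
    (j : ℝ) * Real.pi * ((a : ℝ) / n) + 2 * ((j : ℝ) * Real.pi / (2 * n)) := by
    push_cast; field_simp
  have e2 : (j : ℝ) * Real.pi * (((a - 1 : ℤ) : ℝ) / n) =
    (j : ℝ) * Real.pi * ((a : ℝ) / n) - 2 * ((j : ℝ) * Real.pi / (2 * n)) := by
    push_cast; field_simp
  rw [e1, e2, Real.sin_add, Real.sin_sub, Real.cos_two_mul, Real.cos_sq']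
  ring

lemma aux_eig (d n : ℕ) (hn : 2 ≤ n) (k : Fin d → ℕ) (a : Fin d → ℤ) (i : Fin d) :
    (n : ℝ) ^ 2 * (2 * PhiL d n k a - PhiL d n k (Function.update a i (a i + 1))
      - PhiL d n k (Function.update a i (a i - 1))) = - lamn n (k i) * PhiL d n k a := by
  have h : ∀ v : ℤ, PhiL d n k (Function.update a i v) =
      phiF (k i) ((v : ℝ) / n) * ∏ l ∈ Finset.univ.erase i, phiF (k l) ((a l : ℝ) / n) := by
    intro v
    rw [PhiL, ← Finset.mul_prod_erase _ _ (Finset.mem_univ i)]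
    congr 1
    · simp
    · apply Finset.prod_congr rfl
      intro l hl
      rw [Function.update_of_ne (Finset.ne_of_mem_erase hl)]
  have h0 := h (a i)
  rw [Function.update_eq_self] at h0
  rw [h, h, h0]
  linear_combination (∏ l ∈ Finset.univ.erase i, phiF (k l) ((a l : ℝ) / n)) *
    aux_eig1 n (k i) hn (a i)

lemma aux_phiF_abs (j : ℕ) (x : ℝ) : |phiF j x| ≤ Real.sqrt 2 := by
  rw [phiF, abs_mul, abs_of_nonneg (Real.sqrt_nonneg 2)]
  exact mul_le_of_le_one_right (Real.sqrt_nonneg 2) (Real.abs_sin_le_one _)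

lemma aux_PhiL_abs (d n : ℕ) (k : Fin d → ℕ) (a : Fin d → ℤ) :
    |PhiL d n k a| ≤ Real.sqrt 2 ^ d := by
  rw [PhiL, Finset.abs_prod]
  refine (Finset.prod_le_prod (fun _ _ => abs_nonneg _) (fun i _ => aux_phiF_abs _ _)).trans ?_
  simp

lemma aux_evol (d n : ℕ) (hn : 2 ≤ n) (h : ℝ) (hh : 0 < h) (ks : Finset (Fin d → ℕ))
    (c : (Fin d → ℕ) → ℝ) (h0 : ∀ a, |∑ k ∈ ks, PhiL d n k a * c k| ≤ 1) (M : ℕ) :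
    ∀ a, |∑ k ∈ ks, ((1 - h * ∑ i, lamn n (k i))⁻¹) ^ M * PhiL d n k a * c k| ≤ 1 := by
  have hlam : ∀ j, lamn n j ≤ 0 := by
    intro j; unfold lamn
    have : 0 ≤ (n : ℝ) ^ 2 * Real.sin ((j : ℝ) * Real.pi / (2 * n)) ^ 2 := by positivity
    linarith
  have hpos : ∀ k : Fin d → ℕ, 0 < 1 - h * ∑ i, lamn n (k i) := by
    intro k
    have : ∑ i, lamn n (k i) ≤ 0 := Finset.sum_nonpos fun i _ => hlam _
    nlinarith
  induction M with
  | zero => simpa using h0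
  | succ M ih =>
    refine aux_maxprin d _ _ (∑ k ∈ ks, |((1 - h * ∑ i, lamn n (k i))⁻¹) ^ (M + 1)| *
      Real.sqrt 2 ^ d * |c k|) (h * n ^ 2) (by positivity) ?_ ih ?_
    · intro a
      refine (Finset.abs_sum_le_sum_abs _ _).trans (Finset.sum_le_sum fun k _ => ?_)
      rw [abs_mul, abs_mul]
      gcongr
      exact aux_PhiL_abs d n k a
    · intro a
      rw [Finset.mul_sum]
      simp only [Finset.mul_sum (s := ks), ← Finset.sum_sub_distrib]
      rw [Finset.sum_comm, ← Finset.sum_add_distrib]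
      apply Finset.sum_congr rfl
      intro k _
      have hw := hpos k
      set w := 1 - h * ∑ i, lamn n (k i) with hwdef
      have e : ∀ i ∈ (Finset.univ : Finset (Fin d)), h * (n : ℝ) ^ 2 * (2 * ((w⁻¹) ^ (M + 1) * PhiL d n k a * c k)
          - (w⁻¹) ^ (M + 1) * PhiL d n k (Function.update a i (a i + 1)) * c k
          - (w⁻¹) ^ (M + 1) * PhiL d n k (Function.update a i (a i - 1)) * c k)
          = (h * (w⁻¹) ^ (M + 1) * PhiL d n k a * c k) * (- lamn n (k i)) := by
        intro i _
        linear_combination (h * (w⁻¹) ^ (M + 1) * c k) * aux_eig d n hn k a i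
      rw [Finset.sum_congr rfl e, ← Finset.mul_sum, Finset.sum_neg_distrib]
      have e2 : h * ∑ i, lamn n (k i) = 1 - w := by rw [hwdef]; ring
      have e3 : w⁻¹ * w = 1 := inv_mul_cancel₀ hw.ne'
      rw [pow_succ]
      linear_combination (-(w⁻¹ ^ M * w⁻¹ * PhiL d n k a * c k)) * e2
        + (w⁻¹ ^ M * PhiL d n k a * c k) * e3

lemma aux_start (d n : ℕ) (hn : 2 ≤ n) (s : (Fin d → ℤ) → ℝ) (hs : ∀ b, |s b| ≤ 1)
    (a : Fin d → ℤ) :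
    |∑ k ∈ Finset.Icc (fun _ : Fin d => 1) (fun _ : Fin d => n - 1), PhiL d n k a *
      (((n : ℝ) ^ d)⁻¹ * ∑ b ∈ Fintype.piFinset (fun _ : Fin d => Finset.Icc (0 : ℤ) n),
        s b * PhiL d n k b)| ≤ 1 := by
  have hn0 : (0 : ℝ) < (n : ℝ) ^ d := by positivity
  have e : ∑ k ∈ Finset.Icc (fun _ : Fin d => 1) (fun _ : Fin d => n - 1), PhiL d n k a *
      (((n : ℝ) ^ d)⁻¹ * ∑ b ∈ Fintype.piFinset (fun _ : Fin d => Finset.Icc (0 : ℤ) n),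
        s b * PhiL d n k b) = ((n : ℝ) ^ d)⁻¹ *
      ∑ b ∈ Fintype.piFinset (fun _ : Fin d => Finset.Icc (0 : ℤ) n), s b * ∏ i, Kker n (a i) (b i) := by
    simp only [Finset.mul_sum]
    rw [Finset.sum_comm]
    apply Finset.sum_congr rfl
    intro b _
    have : ∏ i, Kker n (a i) (b i) = ∑ k ∈ Finset.Icc (fun _ : Fin d => 1) (fun _ : Fin d => n - 1),
        PhiL d n k a * PhiL d n k b := by
      simp only [Kker]
      rw [Finset.prod_univ_sum, Pi.Icc_eq]
      apply Finset.sum_congr rfl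
      intro k _
      rw [PhiL, PhiL, Finset.prod_mul_distrib]
    rw [this, Finset.mul_sum, Finset.mul_sum]
    apply Finset.sum_congr rfl
    intro k _
    ring
  rw [e, abs_mul, abs_of_pos (inv_pos.mpr hn0), inv_mul_le_iff₀ hn0, mul_one]
  calc _ ≤ ∑ b ∈ Fintype.piFinset (fun _ : Fin d => Finset.Icc (0 : ℤ) n), ∏ i, |Kker n (a i) (b i)| := by
        refine (Finset.abs_sum_le_sum_abs _ _).trans (Finset.sum_le_sum fun b _ => ?_)
        rw [abs_mul, Finset.abs_prod]
        exact mul_le_of_le_one_left (Finset.prod_nonneg fun _ _ => abs_nonneg _) (hs b)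
    _ = ∏ i, ∑ b ∈ Finset.Icc (0 : ℤ) n, |Kker n (a i) b| := by
        rw [Finset.prod_univ_sum]
    _ ≤ ∏ i : Fin d, (n : ℝ) := Finset.prod_le_prod
        (fun _ _ => Finset.sum_nonneg fun _ _ => abs_nonneg _) (fun i _ => aux_K_sum n hn (a i))
    _ = (n : ℝ) ^ d := by simp

/-- Kernel at lattice target point `b`. -/
noncomputable def Hker (d : ℕ) (T : ℝ) (n m : ℕ) (t : ℝ)
    (x : EuclideanSpace ℝ (Fin d)) (b : Fin d → ℤ) : ℝ :=
  ∑ k ∈ Finset.Icc (fun _ : Fin d => 1) (fun _ : Fin d => n - 1),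
    (1 - T / (m : ℝ) * ∑ i, lamn n (k i)) ^ (-⌊(m : ℝ) * t / T⌋) *
      (∏ i, phiLin n (k i) (x i)) * PhiL d n k b

lemma aux_interp (d n : ℕ) (x : EuclideanSpace ℝ (Fin d)) :
    ∃ (w : Finset (Fin d) → ℝ) (p : Finset (Fin d) → (Fin d → ℤ)),
      (∀ e, 0 ≤ w e) ∧ ∑ e ∈ Finset.univ.powerset, w e = 1 ∧
      ∀ k : Fin d → ℕ, ∏ i, phiLin n (k i) (x i) =
        ∑ e ∈ Finset.univ.powerset, w e * PhiL d n k (p e) := by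
  classical
  refine ⟨fun e => (∏ i ∈ e, (1 - Int.fract ((n : ℝ) * x i))) *
      ∏ i ∈ Finset.univ \ e, Int.fract ((n : ℝ) * x i),
    fun e i => if i ∈ e then ⌊(n : ℝ) * x i⌋ else ⌊(n : ℝ) * x i⌋ + 1, ?_, ?_, ?_⟩
  · intro e
    exact mul_nonneg (Finset.prod_nonneg fun i _ => by linarith [Int.fract_lt_one ((n : ℝ) * x i)])
      (Finset.prod_nonneg fun i _ => Int.fract_nonneg _)
  · rw [← Finset.prod_add]; simp
  · intro k
    have e1 : ∀ i ∈ (Finset.univ : Finset (Fin d)), phiLin n (k i) (x i) =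
        (1 - Int.fract ((n : ℝ) * x i)) * phiF (k i) ((⌊(n : ℝ) * x i⌋ : ℝ) / n) +
        Int.fract ((n : ℝ) * x i) * phiF (k i) (((⌊(n : ℝ) * x i⌋ : ℝ) + 1) / n) := by
      intro i _
      rw [phiLin, ← Int.self_sub_floor]; ring
    rw [Finset.prod_congr rfl e1, Finset.prod_add]
    apply Finset.sum_congr rfl
    intro e he
    rw [PhiL, ← Finset.prod_sdiff (Finset.subset_univ e), Finset.prod_mul_distrib,
      Finset.prod_mul_distrib]
    have a1 : ∏ i ∈ e, phiF (k i) (((if i ∈ e then ⌊(n : ℝ) * x i⌋ else ⌊(n : ℝ) * x i⌋ + 1 : ℤ) : ℝ) / n)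
        = ∏ i ∈ e, phiF (k i) ((⌊(n : ℝ) * x i⌋ : ℝ) / n) :=
      Finset.prod_congr rfl fun i hi => by rw [if_pos hi]
    have a2 : ∏ i ∈ Finset.univ \ e, phiF (k i) (((if i ∈ e then ⌊(n : ℝ) * x i⌋ else ⌊(n : ℝ) * x i⌋ + 1 : ℤ) : ℝ) / n)
        = ∏ i ∈ Finset.univ \ e, phiF (k i) (((⌊(n : ℝ) * x i⌋ : ℝ) + 1) / n) :=
      Finset.prod_congr rfl fun i hi => by
        rw [if_neg (Finset.mem_sdiff.mp hi).2]; push_cast; rfl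
    rw [a1, a2]; ring

lemma aux_sum (d : ℕ) (T : ℝ) (hT : 0 < T) (n m : ℕ) (hn : 2 ≤ n) (hm : 1 ≤ m) (t : ℝ)
    (ht : 0 < t) (x : EuclideanSpace ℝ (Fin d)) :
    ((n : ℝ) ^ d)⁻¹ * ∑ b ∈ Fintype.piFinset (fun _ : Fin d => Finset.Icc (0 : ℤ) n),
      |Hker d T n m t x b| ≤ 1 := by
  have hm0 : (0 : ℝ) < m := by exact_mod_cast hm
  obtain ⟨w, p, hw0, hw1, hwp⟩ := aux_interp d n x
  obtain ⟨M, hM⟩ : ∃ M : ℕ, ⌊(m : ℝ) * t / T⌋ = (M : ℤ) :=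
    Int.eq_ofNat_of_zero_le (Int.floor_nonneg.mpr (by positivity))
  set s : (Fin d → ℤ) → ℝ := fun b => SignType.sign (Hker d T n m t x b) with hs
  have hs1 : ∀ b, |s b| ≤ 1 := by
    intro b
    rcases lt_trichotomy (Hker d T n m t x b) 0 with h | h | h <;> simp [hs, h]
  have hev := aux_evol d n hn (T / m) (by positivity)
    (Finset.Icc (fun _ : Fin d => 1) (fun _ : Fin d => n - 1))
    (fun k => ((n : ℝ) ^ d)⁻¹ * ∑ b ∈ Fintype.piFinset (fun _ : Fin d => Finset.Icc (0 : ℤ) n),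
        s b * PhiL d n k b) (aux_start d n hn s hs1) M
  have e : ((n : ℝ) ^ d)⁻¹ * ∑ b ∈ Fintype.piFinset (fun _ : Fin d => Finset.Icc (0 : ℤ) n),
      |Hker d T n m t x b| = ∑ e ∈ Finset.univ.powerset, w e *
        ∑ k ∈ Finset.Icc (fun _ : Fin d => 1) (fun _ : Fin d => n - 1),
          ((1 - T / m * ∑ i, lamn n (k i))⁻¹) ^ M * PhiL d n k (p e) *
          (((n : ℝ) ^ d)⁻¹ * ∑ b ∈ Fintype.piFinset (fun _ : Fin d => Finset.Icc (0 : ℤ) n),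
            s b * PhiL d n k b) := by
    have e1 : ∀ b, |Hker d T n m t x b| = s b * Hker d T n m t x b := fun b => by
      rw [hs]; exact (sign_mul_self _).symm
    simp only [e1]
    simp only [Hker, hM, zpow_neg, zpow_natCast, hwp, inv_pow]
    simp only [Finset.mul_sum, Finset.sum_mul]
    rw [Finset.sum_comm]
    rw [Finset.sum_comm (s := Finset.univ.powerset)]
    apply Finset.sum_congr rfl
    intro k _
    rw [Finset.sum_comm]
    apply Finset.sum_congr rfl
    intro e _
    apply Finset.sum_congr rfl
    intro b _
    ring
  rw [e]
  refine le_trans ?_ hw1.le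
  apply Finset.sum_le_sum
  intro e _
  exact mul_le_of_le_one_right (hw0 e) ((le_abs_self _).trans (hev (p e)))

/-- Grid cell. -/
def cellE (d n : ℕ) (b : Fin d → ℤ) : Set (EuclideanSpace ℝ (Fin d)) :=
  {y | ∀ i, ⌊(n : ℝ) * y i⌋ = b i}

lemma aux_cell_eq (d n : ℕ) (hn : 2 ≤ n) (b : Fin d → ℤ) :
    cellE d n b = (MeasurableEquiv.toLp 2 (Fin d → ℝ)).symm ⁻¹'
      (Set.univ.pi fun i => Set.Ico ((b i : ℝ) / n) (((b i : ℝ) + 1) / n)) := by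
  have hn0 : (0 : ℝ) < n := by positivity
  ext y
  simp only [cellE, Set.mem_ofPred_eq, Set.mem_preimage, Set.mem_pi, Set.mem_univ, true_imp_iff,
    Set.mem_Ico, Int.floor_eq_iff]
  apply forall_congr'
  intro i
  rw [div_le_iff₀ hn0, lt_div_iff₀ hn0]
  simp [mul_comm]

lemma aux_cell_meas (d n : ℕ) (hn : 2 ≤ n) (b : Fin d → ℤ) : MeasurableSet (cellE d n b) := by
  rw [aux_cell_eq d n hn b]
  exact (MeasurableEquiv.toLp 2 (Fin d → ℝ)).symm.measurable
    (MeasurableSet.univ_pi fun i => measurableSet_Ico)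

lemma aux_cell_vol (d n : ℕ) (hn : 2 ≤ n) (b : Fin d → ℤ) :
    volume (cellE d n b) = ENNReal.ofReal (((n : ℝ) ^ d)⁻¹) := by
  have hn0 : (0 : ℝ) < n := by positivity
  rw [aux_cell_eq d n hn b, (EuclideanSpace.volume_preserving_symm_measurableEquiv_toLp (Fin d)).measure_preimage
    (MeasurableSet.univ_pi fun i => measurableSet_Ico).nullMeasurableSet, Real.volume_pi_Ico]
  have : ∀ i, ((b i : ℝ) + 1) / n - (b i : ℝ) / n = (n : ℝ)⁻¹ := by intro i; field_simp; ring
  simp only [this]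
  rw [Finset.prod_const, Finset.card_univ, Fintype.card_fin, ← ENNReal.ofReal_pow (by positivity),
    inv_pow]

lemma aux_int (d : ℕ) (T : ℝ) (hT : 0 < T) (n m : ℕ) (hn : 2 ≤ n) (hm : 1 ≤ m) (t : ℝ)
    (ht : 0 < t) (x : EuclideanSpace ℝ (Fin d)) :
    (∫ y in Q d, |Gdnm d T n m t x y|) ≤ 1 := by
  have hn0 : (0 : ℝ) < n := by positivity
  refine le_trans ?_ (aux_sum d T hT n m hn hm t ht x)
  set F : EuclideanSpace ℝ (Fin d) → ℝ := fun y =>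
    ∑ b ∈ Fintype.piFinset (fun _ : Fin d => Finset.Icc (0 : ℤ) n),
      (cellE d n b).indicator (fun _ => |Hker d T n m t x b|) y with hF
  have hFi : Integrable F := by
    apply integrable_finsetSum
    intro b _
    rw [integrable_indicator_iff (aux_cell_meas d n hn b)]
    refine integrableOn_const ?_ (by finiteness)
    · rw [aux_cell_vol d n hn b]; exact ENNReal.ofReal_ne_top
  have hF0 : ∀ y, 0 ≤ F y := fun y => Finset.sum_nonneg fun b _ =>
    Set.indicator_nonneg (fun _ _ => abs_nonneg _) _
  have hQm : MeasurableSet (Q d) := by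
    have : Q d = ⋂ i, {x : EuclideanSpace ℝ (Fin d) | x i ∈ Set.Icc (0 : ℝ) 1} := by
      ext; simp [Q]
    rw [this]
    refine MeasurableSet.iInter fun i => ?_
    exact measurableSet_Icc.preimage (by fun_prop)
  calc (∫ y in Q d, |Gdnm d T n m t x y|) ≤ ∫ y in Q d, F y := by
        refine integral_mono_of_nonneg (Filter.Eventually.of_forall fun y => abs_nonneg _)
          hFi.integrableOn ?_
        filter_upwards [ae_restrict_mem hQm] with y hy
        set b : Fin d → ℤ := fun i => ⌊(n : ℝ) * y i⌋ with hb
        have hmem : b ∈ Fintype.piFinset (fun _ : Fin d => Finset.Icc (0 : ℤ) n) := by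
          rw [Fintype.mem_piFinset]
          intro i
          obtain ⟨h0, h1⟩ := hy i
          rw [Finset.mem_Icc]
          refine ⟨Int.floor_nonneg.mpr (by positivity), ?_⟩
          have : (⌊(n : ℝ) * y i⌋ : ℝ) ≤ n := (Int.floor_le _).trans (by nlinarith)
          exact_mod_cast this
        have h1 : |Gdnm d T n m t x y| = (cellE d n b).indicator (fun _ => |Hker d T n m t x b|) y := by
          rw [Set.indicator_of_mem (by intro i; rfl)]
          rfl
        rw [h1]
        exact Finset.single_le_sum (f := fun b =>
          (cellE d n b).indicator (fun _ => |Hker d T n m t x b|) y)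
          (fun b _ => Set.indicator_nonneg (fun _ _ => abs_nonneg _) _) hmem
    _ ≤ ∫ y, F y := setIntegral_le_integral hFi (Filter.Eventually.of_forall hF0)
    _ = _ := by
        rw [hF, integral_finsetSum]
        · rw [Finset.mul_sum]
          apply Finset.sum_congr rfl
          intro b _
          rw [integral_indicator_const _ (aux_cell_meas d n hn b), Measure.real,
            aux_cell_vol d n hn b, ENNReal.toReal_ofReal (by positivity), smul_eq_mul]
        · intro b _
          rw [integrable_indicator_iff (aux_cell_meas d n hn b)]
          refine integrableOn_const ?_ (by finiteness)
          rw [aux_cell_vol d n hn b]; exact ENNReal.ofReal_ne_top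

/-- `L¹` bound for the implicit space-time discretized Green function. -/
theorem stmt_11 (d : ℕ) (hd : 1 ≤ d) (T : ℝ) (hT : 0 < T) (lam : ℝ)
    (hlam : lam ∈ Set.Ioo (0 : ℝ) (1 / 2)) :
    ∃ c C : ℝ, 0 < c ∧ 0 < C ∧ ∀ n : ℕ, 2 ≤ n → ∀ m : ℕ, 1 ≤ m →
      ∀ t ∈ Set.Ioc (0 : ℝ) T, ∀ x ∈ Q d,
      (∫ y in Q d, |Gdnm d T n m t x y|) ≤ C * Real.exp (-c * t) * (1 + t ^ (-lam)) := by
  refine ⟨1, Real.exp T, one_pos, Real.exp_pos T, ?_⟩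
  intro n hn m hm t ht x _
  refine (aux_int d T hT n m hn hm t ht.1 x).trans ?_
  have h1 : 1 ≤ Real.exp T * Real.exp (-1 * t) := by
    rw [← Real.exp_add]
    exact Real.one_le_exp (by linarith [ht.2])
  have h2 : 0 ≤ t ^ (-lam) := Real.rpow_nonneg ht.1.le _
  nlinarith
end

section
/- Let $d\ge 1$. There exists a constant $C>0$ such that for all integers $n\ge 2$: $\int_0^{\infty} \sup_{x\in Q}\int_Q |G_d(t,x,y)-(G_d)^n(t,x,y)|\, dy\, dt \le C\, n^{-1}$. -/
open MeasureTheory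

namespace Aux
open Real Finset

lemma cos_sum (n m : ℕ) (hm : 0 < m) (hmn : m < 2 * n) :
    ∑ k ∈ range n, cos (π * m * k / n) = (1 - cos (π * m)) / 2 := by
  have hn : (0:ℝ) < n := by
    have : 0 < n := by omega
    exact_mod_cast this
  set α : ℝ := π * m / n with hα
  have hs : 0 < sin (α / 2) := by
    apply sin_pos_of_pos_of_lt_pi
    · have : (0:ℝ) < m := by exact_mod_cast hm
      positivity
    · rw [hα, div_div, div_lt_iff₀ (by positivity)]
      have : (m:ℝ) < 2 * n := by exact_mod_cast hmn
      nlinarith [pi_pos]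
  have key : ∀ N : ℕ, 2 * sin (α / 2) * ∑ k ∈ range N, cos (k * α)
      = sin (N * α - α / 2) + sin (α / 2) := by
    intro N
    induction N with
    | zero => simp [sin_neg]
    | succ N ih =>
      rw [sum_range_succ, mul_add, ih]
      push_cast
      have e1 : ((N:ℝ) + 1) * α - α / 2 = N * α + α / 2 := by ring
      rw [e1, sin_add, sin_sub]
      ring
  have h := key n
  have e2 : (n:ℝ) * α = π * m := by rw [hα]; field_simp
  have e3 : sin (π * m) = 0 := by rw [mul_comm]; exact sin_nat_mul_pi m
  rw [e2, sin_sub, e3] at h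
  have e4 : ∑ k ∈ range n, cos (π * m * k / n) = ∑ k ∈ range n, cos (k * α) := by
    apply sum_congr rfl
    intro k _
    congr 1
    rw [hα]; ring
  rw [e4]
  have : sin (α / 2) * (2 * ∑ k ∈ range n, cos (k * α) - (1 - cos (π * m))) = 0 := by
    linarith
  rcases mul_eq_zero.mp this with h0 | h0
  · exact absurd h0 hs.ne'
  · linarith

lemma disc_orth_aux (n j l : ℕ) (hl : 1 ≤ l) (hlj : l < j) (hjn : j < n) :
    ∑ k ∈ range n, sin (π * j * k / n) * sin (π * l * k / n) = 0 := by
  obtain ⟨m, rfl⟩ := Nat.exists_eq_add_of_lt hlj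
  have h1 := cos_sum n (m + 1) (by omega) (by omega)
  have h2 := cos_sum n (l + m + 1 + l) (by omega) (by omega)
  have : ∀ k ∈ range n, sin (π * (l + m + 1 : ℕ) * k / n) * sin (π * l * k / n)
      = (cos (π * (m + 1 : ℕ) * k / n) - cos (π * (l + m + 1 + l : ℕ) * k / n)) / 2 := by
    intro k _
    have ea : π * (m + 1 : ℕ) * k / n = π * (l + m + 1 : ℕ) * k / n - π * l * k / n := by
      push_cast; ring
    have eb : π * (l + m + 1 + l : ℕ) * k / n = π * (l + m + 1 : ℕ) * k / n + π * l * k / n := by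
      push_cast; ring
    rw [ea, eb, cos_sub, cos_add]; ring
  rw [sum_congr rfl this, ← sum_div, sum_sub_distrib, h1, h2]
  have e : π * (l + m + 1 + l : ℕ) = π * (m + 1 : ℕ) + l * (2 * π) := by push_cast; ring
  rw [e, cos_add_nat_mul_two_pi]
  ring

lemma disc_orth (n j l : ℕ) (hj : 1 ≤ j) (hjn : j < n) (hl : 1 ≤ l) (hln : l < n) :
    ∑ k ∈ range n, sin (π * j * k / n) * sin (π * l * k / n) = if j = l then (n:ℝ) / 2 else 0 := by
  split_ifs with h
  · subst h
    have h2 := cos_sum n (2 * j) (by omega) (by omega)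
    have : ∀ k ∈ range n, sin (π * j * k / n) * sin (π * j * k / n)
      = (1 - cos (π * (2 * j : ℕ) * k / n)) / 2 := by
      intro k _
      have eb : π * (2 * j : ℕ) * k / n = 2 * (π * j * k / n) := by
        push_cast; ring
      rw [eb, cos_two_mul, cos_sq']; ring
    rw [sum_congr rfl this, ← sum_div, sum_sub_distrib, h2]
    have e : π * (2 * j : ℕ) = j * (2 * π) := by push_cast; ring
    rw [e, cos_nat_mul_two_pi]
    simp
  · rcases lt_or_gt_of_ne h with h | h
    · rw [← disc_orth_aux n l j hj h hln]
      exact sum_congr rfl fun k _ => mul_comm _ _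
    · exact disc_orth_aux n j l hl h hjn

lemma phi_disc (n j l : ℕ) (hj : 1 ≤ j) (hjn : j < n) (hl : 1 ≤ l) (hln : l < n) :
    ∑ k ∈ range n, phiF j ((k:ℝ) / n) * phiF l ((k:ℝ) / n) = if j = l then (n:ℝ) else 0 := by
  have h := disc_orth n j l hj hjn hl hln
  have e : ∀ k ∈ range n, phiF j ((k:ℝ) / n) * phiF l ((k:ℝ) / n)
      = 2 * (sin (π * j * k / n) * sin (π * l * k / n)) := by
    intro k _
    unfold phiF
    have s2 : √2 * √2 = (2:ℝ) := mul_self_sqrt (by norm_num)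
    rw [show (j:ℝ) * π * (k / n) = π * j * k / n by ring,
      show (l:ℝ) * π * (k / n) = π * l * k / n by ring]
    linear_combination (sin (π * j * k / n) * sin (π * l * k / n)) * s2
  rw [sum_congr rfl e, ← mul_sum, h]
  split_ifs <;> ring

lemma phi_disc' (n i k : ℕ) (hi : 1 ≤ i) (hin : i < n) (hk : 1 ≤ k) (hkn : k < n) :
    ∑ j ∈ Icc 1 (n-1), phiF j ((i:ℝ) / n) * phiF j ((k:ℝ) / n) = if i = k then (n:ℝ) else 0 := by
  rw [← phi_disc n i k hi hin hk hkn]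
  have hr : range n = insert 0 (Icc 1 (n-1)) := by ext; simp; omega
  rw [hr, sum_insert (by simp)]
  have : phiF i (((0:ℕ):ℝ) / n) = 0 := by simp [phiF]
  rw [this, zero_mul, zero_add]
  apply sum_congr rfl
  intro j _
  unfold phiF
  rw [show (i:ℝ) * π * (j / n) = j * π * (i / n) by ring,
      show (k:ℝ) * π * (j / n) = j * π * (k / n) by ring]

/-- powers of the transition matrix -/
noncomputable def am (n m i k : ℕ) : ℝ :=
  ∑ j ∈ Icc 1 (n-1), cos (j * π / n) ^ m * phiF j ((i:ℝ) / n) * phiF j ((k:ℝ) / n)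

lemma am_zero_i (n m k : ℕ) : am n m 0 k = 0 := by simp [am, phiF]

lemma am_n_i (n m k : ℕ) (hn : 0 < n) : am n m n k = 0 := by
  have : (n:ℝ) ≠ 0 := by positivity
  unfold am phiF
  apply sum_eq_zero
  intro j _
  rw [div_self this, mul_one, sin_nat_mul_pi]; simp

lemma am_succ (n m i k : ℕ) (hi : 1 ≤ i) :
    am n (m+1) i k = (am n m (i+1) k + am n m (i-1) k) / 2 := by
  unfold am
  rw [← sum_add_distrib, sum_div]
  apply sum_congr rfl
  intro j _
  unfold phiF
  obtain ⟨i, rfl⟩ := Nat.exists_eq_add_of_le' hi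
  simp only [Nat.add_sub_cancel]
  push_cast
  rw [show (j:ℝ) * π * ((i + 1 + 1) / n) = j * π * ((i+1) / n) + j * π / n by ring,
    show (j:ℝ) * π * (i / n) = j * π * ((i+1) / n) - j * π / n by ring, sin_add, sin_sub]
  ring

lemma am_bound (n m : ℕ) (hn : 2 ≤ n) : ∀ i ≤ n, ∑ k ∈ range n, |am n m i k| ≤ n := by
  induction m with
  | zero =>
    intro i hi
    rcases Nat.eq_zero_or_pos i with rfl | hi0
    · simp [am_zero_i]
    rcases hi.eq_or_lt with rfl | hi1
    · simp [am_n_i i 0 _ (by omega)]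
    have : ∀ k ∈ range n, |am n 0 i k| = if i = k then (n:ℝ) else 0 := by
      intro k hk
      rcases Nat.eq_zero_or_pos k with rfl | hk0
      · simp [am, phiF]; omega
      have := phi_disc' n i k hi0 hi1 hk0 (by simpa using hk)
      unfold am
      simp only [pow_zero, one_mul]
      rw [this]
      split_ifs <;> simp
    rw [sum_congr rfl this]
    simp [hi1]
  | succ m ih =>
    intro i hi
    rcases Nat.eq_zero_or_pos i with rfl | hi0
    · simp [am_zero_i]
    rcases hi.eq_or_lt with rfl | hi1
    · simp [am_n_i i _ _ (by omega)]
    calc ∑ k ∈ range n, |am n (m+1) i k|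
        ≤ ∑ k ∈ range n, (|am n m (i+1) k| + |am n m (i-1) k|) / 2 := by
          apply sum_le_sum
          intro k _
          rw [am_succ n m i k hi0, abs_div, abs_two]
          gcongr
          exact abs_add_le _ _
      _ ≤ n := by
          rw [← sum_div, sum_add_distrib]
          have := ih (i+1) (by omega)
          have := ih (i-1) (by omega)
          linarith

noncomputable def un (n : ℕ) (t : ℝ) (i k : ℕ) : ℝ :=
  ∑ j ∈ Icc 1 (n-1), exp (lamn n j * t) * phiF j ((i:ℝ) / n) * phiF j ((k:ℝ) / n)

lemma un_bound (n : ℕ) (hn : 2 ≤ n) (t : ℝ) (ht : 0 ≤ t) (i : ℕ) (hi : i ≤ n) :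
    ∑ k ∈ range n, |un n t i k| ≤ n := by
  set s : ℝ := 2 * n ^ 2 * t with hs
  have hs0 : 0 ≤ s := by positivity
  have hE : ∀ x : ℝ, Filter.Tendsto (fun M : ℕ => ∑ m ∈ range M, x ^ m / m.factorial)
      Filter.atTop (nhds (exp x)) := by
    intro x
    rw [exp_eq_exp_ℝ]
    exact (NormedSpace.expSeries_div_hasSum_exp (𝔸 := ℝ) x).tendsto_sum_nat
  have hlam : ∀ j : ℕ, exp (lamn n j * t) = exp (-s) * exp (s * cos (j * π / n)) := by
    intro j
    rw [← exp_add]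
    congr 1
    unfold lamn
    have : (j:ℝ) * π / n = 2 * (j * π / (2 * n)) := by ring
    rw [this, cos_two_mul, cos_sq', hs]; ring
  have hT : ∀ k, Filter.Tendsto (fun M : ℕ => exp (-s) * ∑ m ∈ range M, s ^ m / m.factorial * am n m i k)
      Filter.atTop (nhds (un n t i k)) := by
    intro k
    have e1 : un n t i k = exp (-s) * ∑ j ∈ Icc 1 (n-1), exp (s * cos (j * π / n)) *
        (phiF j ((i:ℝ) / n) * phiF j ((k:ℝ) / n)) := by
      unfold un
      rw [mul_sum]
      exact sum_congr rfl fun j _ => by rw [hlam]; ring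
    rw [e1]
    apply Filter.Tendsto.const_mul
    have e2 : ∀ M : ℕ, ∑ m ∈ range M, s ^ m / m.factorial * am n m i k
        = ∑ j ∈ Icc 1 (n-1), (∑ m ∈ range M, (s * cos (j * π / n)) ^ m / m.factorial) *
        (phiF j ((i:ℝ) / n) * phiF j ((k:ℝ) / n)) := by
      intro M
      unfold am
      simp_rw [mul_sum, sum_mul]
      rw [sum_comm]
      refine sum_congr rfl fun j _ => sum_congr rfl fun m _ => ?_
      rw [mul_pow]; ring
    simp_rw [e2]
    apply tendsto_finsetSum
    intro j _
    exact (hE _).mul_const _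
  have hT2 : Filter.Tendsto (fun M : ℕ => ∑ k ∈ range n,
      |exp (-s) * ∑ m ∈ range M, s ^ m / m.factorial * am n m i k|)
      Filter.atTop (nhds (∑ k ∈ range n, |un n t i k|)) :=
    tendsto_finsetSum _ fun k _ => (hT k).abs
  refine le_of_tendsto' hT2 fun M => ?_
  calc ∑ k ∈ range n, |exp (-s) * ∑ m ∈ range M, s ^ m / m.factorial * am n m i k|
      ≤ ∑ k ∈ range n, exp (-s) * ∑ m ∈ range M, s ^ m / m.factorial * |am n m i k| := by
        apply sum_le_sum
        intro k _
        rw [abs_mul, abs_of_pos (exp_pos _)]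
        gcongr
        refine (abs_sum_le_sum_abs _ _).trans (sum_le_sum fun m _ => ?_)
        rw [abs_mul, abs_of_nonneg (by positivity)]
    _ = exp (-s) * ∑ m ∈ range M, s ^ m / m.factorial * ∑ k ∈ range n, |am n m i k| := by
        rw [← mul_sum, sum_comm]
        simp_rw [mul_sum]
    _ ≤ exp (-s) * ∑ m ∈ range M, s ^ m / m.factorial * n := by
        gcongr with m _
        exact am_bound n m hn i hi
    _ ≤ exp (-s) * (exp s * n) := by
        rw [← sum_mul]
        gcongr
        exact sum_le_exp_of_nonneg hs0 M
    _ = n := by rw [← mul_assoc, ← exp_add]; simp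

end Aux
namespace Aux
open Real Finset

lemma kappa_cell (n : ℕ) (hn : 0 < n) (k : ℕ) (y : ℝ)
    (h1 : (k:ℝ) / n ≤ y) (h2 : y < ((k + 1 : ℕ):ℝ) / n) : kappa n y = (k:ℝ) / n := by
  have hn' : (0:ℝ) < n := by exact_mod_cast hn
  unfold kappa
  congr 1
  have : ⌊(n:ℝ) * y⌋ = (k:ℤ) := by
    rw [Int.floor_eq_iff]
    rw [div_le_iff₀ hn'] at h1
    rw [lt_div_iff₀ hn'] at h2
    push_cast at *
    constructor <;> linarith
  rw [this]; simp

lemma cell_congr (n : ℕ) (hn : 0 < n) (k : ℕ) (F : ℝ → ℝ → ℝ) :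
    Set.EqOn (fun y => F y (kappa n y)) (fun y => F y ((k:ℝ)/n))
      (Set.Ioo ((k:ℝ)/n) (((k + 1 : ℕ):ℝ)/n)) := by
  intro y hy
  simp only
  rw [kappa_cell n hn k y hy.1.le hy.2]

lemma cell_le (n k : ℕ) : (k:ℝ)/n ≤ ((k + 1 : ℕ):ℝ)/n := by
  gcongr; simp

lemma cell_int (n : ℕ) (hn : 0 < n) (k : ℕ) (F : ℝ → ℝ → ℝ)
    (hF : ∀ a, Continuous fun y => F y a) :
    IntervalIntegrable (fun y => F y (kappa n y)) volume ((k:ℝ)/n) (((k + 1 : ℕ):ℝ)/n) ∧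
    ∫ y in ((k:ℝ)/n)..(((k + 1 : ℕ):ℝ)/n), F y (kappa n y) =
      ∫ y in ((k:ℝ)/n)..(((k + 1 : ℕ):ℝ)/n), F y ((k:ℝ)/n) := by
  have hc := cell_congr n hn k F
  have h2 : IntervalIntegrable (fun y => F y ((k:ℝ)/n)) volume ((k:ℝ)/n) (((k + 1 : ℕ):ℝ)/n) :=
    (hF _).intervalIntegrable _ _
  have hae : (fun y => F y (kappa n y)) =ᵐ[volume.restrict (Set.Ioc ((k:ℝ)/n) (((k + 1 : ℕ):ℝ)/n))]
      (fun y => F y ((k:ℝ)/n)) := by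
    rw [← Measure.restrict_congr_set Ioo_ae_eq_Ioc]
    exact (ae_restrict_mem measurableSet_Ioo).mono fun y hy => hc hy
  constructor
  · rw [intervalIntegrable_iff_integrableOn_Ioc_of_le (cell_le n k)] at h2 ⊢
    exact h2.congr hae.symm
  · rw [intervalIntegral.integral_of_le (cell_le n k), intervalIntegral.integral_of_le (cell_le n k)]
    exact integral_congr_ae hae

lemma step_int (n : ℕ) (hn : 0 < n) (F : ℝ → ℝ → ℝ) (hF : ∀ a, Continuous fun y => F y a) :
    IntervalIntegrable (fun y => F y (kappa n y)) volume 0 1 ∧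
    ∫ y in (0:ℝ)..1, F y (kappa n y) =
      ∑ k ∈ range n, ∫ y in ((k:ℝ)/n)..(((k + 1 : ℕ):ℝ)/n), F y ((k:ℝ)/n) := by
  have hn' : (n:ℝ) ≠ 0 := by positivity
  have h1 := IntervalIntegrable.trans_iterate (μ := volume) (f := fun y => F y (kappa n y))
    (a := fun k : ℕ => (k:ℝ)/n) (n := n) (fun k _ => (cell_int n hn k F hF).1)
  have h2 := intervalIntegral.sum_integral_adjacent_intervals (μ := volume)
    (f := fun y => F y (kappa n y))
    (a := fun k : ℕ => (k:ℝ)/n) (n := n) (fun k _ => (cell_int n hn k F hF).1)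
  simp only [Nat.cast_zero, zero_div, div_self hn'] at h1 h2
  refine ⟨h1, ?_⟩
  rw [← h2]
  exact sum_congr rfl fun k _ => (cell_int n hn k F hF).2

lemma step_int' (n : ℕ) (hn : 0 < n) (F : ℝ → ℝ) :
    IntervalIntegrable (fun y => F (kappa n y)) volume 0 1 ∧
    ∫ y in (0:ℝ)..1, F (kappa n y) = (∑ k ∈ range n, F ((k:ℝ)/n)) / n := by
  have h := step_int n hn (fun _ a => F a) (fun a => continuous_const)
  refine ⟨h.1, ?_⟩
  rw [h.2, sum_div]
  apply sum_congr rfl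
  intro k _
  rw [intervalIntegral.integral_const]
  push_cast
  simp only [smul_eq_mul]
  ring

/-- Pythagoras -/
lemma pyth (s : Finset ℕ) (ψ : ℕ → ℝ → ℝ) (c w : ℕ → ℝ)
    (hi : ∀ j ∈ s, ∀ l ∈ s, IntervalIntegrable (fun y => ψ j y * ψ l y) volume 0 1)
    (ho : ∀ j ∈ s, ∀ l ∈ s, ∫ y in (0:ℝ)..1, ψ j y * ψ l y = if j = l then w j else 0) :
    ∫ y in (0:ℝ)..1, (∑ j ∈ s, c j * ψ j y) ^ 2 = ∑ j ∈ s, c j ^ 2 * w j := by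
  have e : ∀ y, (∑ j ∈ s, c j * ψ j y) ^ 2 = ∑ j ∈ s, ∑ l ∈ s, (c j * c l) * (ψ j y * ψ l y) := by
    intro y
    rw [sq, sum_mul_sum]
    exact sum_congr rfl fun j _ => sum_congr rfl fun l _ => by ring
  simp_rw [e]
  rw [intervalIntegral.integral_finsetSum
    (fun j hj => by
      simpa only [Finset.sum_fn] using IntervalIntegrable.sum s
        (f := fun l y => (c j * c l) * (ψ j y * ψ l y)) fun l hl => (hi j hj l hl).const_mul _)]
  apply sum_congr rfl
  intro j hj
  rw [intervalIntegral.integral_finsetSum (fun l hl => (hi j hj l hl).const_mul _)]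
  rw [sum_congr rfl (g := fun l => if j = l then c j ^ 2 * w j else 0)]
  · simp [hj]
  · intro l hl
    rw [intervalIntegral.integral_const_mul, ho j hj l hl]
    split_ifs with h
    · subst h; ring
    · ring

/-- Cauchy-Schwarz -/
lemma cs_int (f : ℝ → ℝ) (a b : ℝ) (hab : a ≤ b) (hf : IntervalIntegrable f volume a b)
    (hf2 : IntervalIntegrable (fun y => f y ^ 2) volume a b) :
    (∫ y in a..b, f y) ^ 2 ≤ (b - a) * ∫ y in a..b, f y ^ 2 := by
  rcases hab.eq_or_lt with rfl | hab'
  · simp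
  set m : ℝ := (∫ y in a..b, f y) / (b - a) with hm
  have hpos : 0 < b - a := by linarith
  have h0 : 0 ≤ ∫ y in a..b, (f y - m) ^ 2 :=
    intervalIntegral.integral_nonneg hab fun y _ => sq_nonneg _
  have e : ∀ y, (f y - m) ^ 2 = f y ^ 2 - (2 * m) * f y + m ^ 2 := fun y => by ring
  simp_rw [e] at h0
  rw [intervalIntegral.integral_add (hf2.sub (hf.const_mul _)) intervalIntegrable_const,
    intervalIntegral.integral_sub hf2 (hf.const_mul _), intervalIntegral.integral_const_mul,
    intervalIntegral.integral_const] at h0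
  have e2 : ∫ y in a..b, f y = m * (b - a) := by rw [hm]; field_simp
  rw [e2] at h0 ⊢
  simp only [smul_eq_mul] at h0
  nlinarith

lemma poincare_cell (g g' : ℝ → ℝ) (hg : ∀ y, HasDerivAt g (g' y) y) (hc : Continuous g')
    (a b : ℝ) (hab : a ≤ b) :
    ∫ y in a..b, (g y - g a) ^ 2 ≤ (b - a) ^ 2 * ∫ y in a..b, g' y ^ 2 := by
  have hgc : Continuous g := continuous_iff_continuousAt.mpr fun y => (hg y).continuousAt
  have hp : ∀ y ∈ Set.Icc a b, (g y - g a) ^ 2 ≤ (b - a) * ∫ y in a..b, g' y ^ 2 := by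
    intro y hy
    have h1 : ∫ z in a..y, g' z = g y - g a :=
      intervalIntegral.integral_eq_sub_of_hasDerivAt (fun z _ => hg z) (hc.intervalIntegrable _ _)
    rw [← h1]
    refine (cs_int g' a y hy.1 (hc.intervalIntegrable _ _)
      ((hc.pow 2).intervalIntegrable _ _)).trans ?_
    have hm : ∫ z in a..y, g' z ^ 2 ≤ ∫ z in a..b, g' z ^ 2 :=
      intervalIntegral.integral_mono_interval le_rfl hy.1 hy.2
        (Filter.Eventually.of_forall fun z => sq_nonneg _) ((hc.pow 2).intervalIntegrable _ _)
    have h0 : 0 ≤ ∫ z in a..y, g' z ^ 2 :=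
      intervalIntegral.integral_nonneg hy.1 fun z _ => sq_nonneg _
    have := hy.2
    have := hy.1
    apply mul_le_mul (by linarith) hm h0 (by linarith)
  calc ∫ y in a..b, (g y - g a) ^ 2 ≤ ∫ y in a..b, (b - a) * ∫ y in a..b, g' y ^ 2 :=
        intervalIntegral.integral_mono_on hab
          (((hgc.sub continuous_const).pow 2).intervalIntegrable _ _) intervalIntegrable_const hp
    _ = _ := by
        rw [intervalIntegral.integral_const, smul_eq_mul]; ring

lemma poincare (n : ℕ) (hn : 0 < n) (g g' : ℝ → ℝ) (hg : ∀ y, HasDerivAt g (g' y) y)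
    (hc : Continuous g') :
    ∫ y in (0:ℝ)..1, (g y - g (kappa n y)) ^ 2 ≤ (1 / (n:ℝ)) ^ 2 * ∫ y in (0:ℝ)..1, g' y ^ 2 := by
  have hgc : Continuous g := continuous_iff_continuousAt.mpr fun y => (hg y).continuousAt
  rw [(step_int n hn (fun y a => (g y - g a) ^ 2) (fun a => by fun_prop)).2,
    (step_int n hn (fun y _ => g' y ^ 2) (fun a => by fun_prop)).2, mul_sum]
  apply sum_le_sum
  intro k _
  have := poincare_cell g g' hg hc _ _ (cell_le n k)
  have e : ((k + 1 : ℕ):ℝ) / n - (k:ℝ) / n = 1 / n := by push_cast; ring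
  rwa [e] at this

lemma int_cos (m : ℕ) (hm : 0 < m) : ∫ y in (0:ℝ)..1, cos (m * π * y) = 0 := by
  have : (m:ℝ) * π ≠ 0 := by positivity
  rw [intervalIntegral.integral_comp_mul_left (fun x => cos x) this]
  simp [sin_nat_mul_pi]

lemma trig_orth_aux (j l : ℕ) (hl : 1 ≤ l) (hlj : l ≤ j) :
    (∫ y in (0:ℝ)..1, sin (j * π * y) * sin (l * π * y) = if j = l then 1/2 else 0) ∧
    (∫ y in (0:ℝ)..1, cos (j * π * y) * cos (l * π * y) = if j = l then 1/2 else 0) := by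
  obtain ⟨m, rfl⟩ := Nat.exists_eq_add_of_le hlj
  have h2 := int_cos (l + m + l) (by omega)
  have h1 : ∫ y in (0:ℝ)..1, cos (m * π * y) = if l + m = l then 1 else 0 := by
    rcases Nat.eq_zero_or_pos m with rfl | hm
    · simp
    · rw [int_cos m hm, if_neg (by omega)]
  have ea : ∀ y : ℝ, m * π * y = (l + m : ℕ) * π * y - l * π * y := by
    intro y; push_cast; ring
  have eb : ∀ y : ℝ, (l + m + l : ℕ) * π * y = (l + m : ℕ) * π * y + l * π * y := by
    intro y; push_cast; ring
  have ic : ∀ m : ℕ, IntervalIntegrable (fun y => cos (m * π * y)) volume 0 1 := fun m =>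
    Continuous.intervalIntegrable (by fun_prop) _ _
  constructor
  · have : ∀ y : ℝ, sin ((l + m : ℕ) * π * y) * sin (l * π * y)
      = (cos (m * π * y) - cos ((l + m + l : ℕ) * π * y)) / 2 := by
      intro y
      rw [ea, eb, cos_sub, cos_add]; ring
    simp_rw [this]
    rw [intervalIntegral.integral_div, intervalIntegral.integral_sub (ic _) (ic _), h1, h2]
    split_ifs <;> norm_num
  · have : ∀ y : ℝ, cos ((l + m : ℕ) * π * y) * cos (l * π * y)
      = (cos (m * π * y) + cos ((l + m + l : ℕ) * π * y)) / 2 := by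
      intro y
      rw [ea, eb, cos_sub, cos_add]; ring
    simp_rw [this]
    rw [intervalIntegral.integral_div, intervalIntegral.integral_add (ic _) (ic _), h1, h2]
    split_ifs <;> norm_num

lemma trig_orth (j l : ℕ) (hj : 1 ≤ j) (hl : 1 ≤ l) :
    (∫ y in (0:ℝ)..1, sin (j * π * y) * sin (l * π * y) = if j = l then 1/2 else 0) ∧
    (∫ y in (0:ℝ)..1, cos (j * π * y) * cos (l * π * y) = if j = l then 1/2 else 0) := by
  rcases le_total l j with h | h
  · exact trig_orth_aux j l hl h
  · have := trig_orth_aux l j hj h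
    simp_rw [eq_comm (a := j), mul_comm (sin (j * π * _)), mul_comm (cos (j * π * _))]
    exact this

lemma phi_cont (j : ℕ) : Continuous (phiF j) := by unfold phiF; fun_prop

lemma sq_phi (s : Finset ℕ) (hs : ∀ j ∈ s, 1 ≤ j) (c : ℕ → ℝ) :
    ∫ y in (0:ℝ)..1, (∑ j ∈ s, c j * phiF j y) ^ 2 = ∑ j ∈ s, c j ^ 2 := by
  rw [pyth s phiF c (fun _ => 1)]
  · simp
  · intro j _ l _
    exact ((phi_cont j).mul (phi_cont l)).intervalIntegrable _ _
  · intro j hj l hl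
    unfold phiF
    have s2 : √2 * √2 = (2:ℝ) := mul_self_sqrt (by norm_num)
    have : ∀ y : ℝ, √2 * sin (j * π * y) * (√2 * sin (l * π * y))
        = 2 * (sin (j * π * y) * sin (l * π * y)) := by
      intro y
      linear_combination (sin (j * π * y) * sin (l * π * y)) * s2
    simp_rw [this]
    rw [intervalIntegral.integral_const_mul, (trig_orth j l (hs j hj) (hs l hl)).1]
    split_ifs <;> norm_num

lemma sq_cos (s : Finset ℕ) (hs : ∀ j ∈ s, 1 ≤ j) (c : ℕ → ℝ) :
    ∫ y in (0:ℝ)..1, (∑ j ∈ s, c j * cos (j * π * y)) ^ 2 = ∑ j ∈ s, c j ^ 2 * (1/2) := by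
  rw [pyth s (fun j y => cos (j * π * y)) c (fun _ => 1/2)]
  · intro j _ l _
    exact Continuous.intervalIntegrable (by fun_prop) _ _
  · intro j hj l hl
    exact (trig_orth j l (hs j hj) (hs l hl)).2

lemma sq_phi_kappa (n : ℕ) (hn : 2 ≤ n) (c : ℕ → ℝ) :
    ∫ y in (0:ℝ)..1, (∑ j ∈ Icc 1 (n-1), c j * phiF j (kappa n y)) ^ 2
      = ∑ j ∈ Icc 1 (n-1), c j ^ 2 := by
  rw [pyth (Icc 1 (n-1)) (fun j y => phiF j (kappa n y)) c (fun _ => 1)]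
  · simp
  · intro j _ l _
    exact (step_int' n (by omega) (fun a => phiF j a * phiF l a)).1
  · intro j hj l hl
    rw [mem_Icc] at hj hl
    have hn' : (n:ℝ) ≠ 0 := by positivity
    rw [(step_int' n (by omega) (fun a => phiF j a * phiF l a)).2,
      phi_disc n j l (by omega) (by omega) (by omega) (by omega)]
    split_ifs
    · field_simp
    · simp

end Aux
namespace Aux
open Real Finset

lemma phi_abs (j : ℕ) (x : ℝ) : |phiF j x| ≤ √2 := by
  unfold phiF
  rw [abs_mul, abs_of_nonneg (sqrt_nonneg 2)]
  exact mul_le_of_le_one_right (sqrt_nonneg 2) (abs_sin_le_one _)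

lemma phi_lip (j : ℕ) (x y : ℝ) : |phiF j x - phiF j y| ≤ √2 * (j * π * |x - y|) := by
  unfold phiF
  rw [← mul_sub, abs_mul, abs_of_nonneg (sqrt_nonneg 2)]
  gcongr
  refine (abs_sin_sub_sin_le _ _).trans (le_of_eq ?_)
  rw [← mul_sub, abs_mul, abs_of_nonneg (by positivity)]

lemma phiLin_err (n j : ℕ) (hn : 0 < n) (x : ℝ) :
    |phiF j x - phiLin n j x| ≤ 2 * √2 * π * (j / n) := by
  have hn' : (0:ℝ) < n := by exact_mod_cast hn
  unfold phiLin
  set i : ℝ := (⌊(n:ℝ) * x⌋ : ℝ) with hi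
  have h1 : i ≤ n * x := Int.floor_le _
  have h2 : n * x < i + 1 := Int.lt_floor_add_one _
  have a1 : |x - i / n| ≤ 1 / n := by
    rw [abs_of_nonneg]
    · rw [sub_le_iff_le_add, ← add_div, le_div_iff₀ hn']; linarith
    · rw [sub_nonneg, div_le_iff₀ hn']; linarith
  have a2 : |(i + 1) / n - i / n| ≤ 1 / n := by
    rw [← sub_div, add_sub_cancel_left, abs_of_pos (by positivity)]
  have b1 := phi_lip j x (i / n)
  have b2 := phi_lip j ((i + 1) / n) (i / n)
  have c1 : |phiF j x - phiF j (i / n)| ≤ √2 * (j * π * (1 / n)) := b1.trans (by gcongr)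
  have c2 : |phiF j ((i + 1) / n) - phiF j (i / n)| ≤ √2 * (j * π * (1 / n)) := b2.trans (by gcongr)
  have c3 : |(n * x - i) * (phiF j ((i + 1) / n) - phiF j (i / n))| ≤ √2 * (j * π * (1 / n)) := by
    rw [abs_mul]
    refine le_trans (mul_le_of_le_one_left (abs_nonneg _) ?_) c2
    rw [abs_of_nonneg] <;> linarith
  calc _ = |(phiF j x - phiF j (i / n)) - (n * x - i) * (phiF j ((i + 1) / n) - phiF j (i / n))| := by
        congr 1; ring
    _ ≤ √2 * (j * π * (1 / n)) + √2 * (j * π * (1 / n)) := (abs_sub _ _).trans (add_le_add c1 c3)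
    _ = _ := by ring

lemma lam_upper (n j : ℕ) (hj : 1 ≤ j) (hjn : j < n) : lamn n j ≤ -(4 * (j:ℝ) ^ 2) := by
  have hn' : (0:ℝ) < n := by exact_mod_cast (by omega : 0 < n)
  unfold lamn
  have hj' : (j:ℝ) ≤ n := by exact_mod_cast hjn.le
  have h := mul_le_sin (x := (j:ℝ) * π / (2 * n)) (by positivity) (by
    rw [div_le_div_iff₀ (by positivity) (by positivity)]
    nlinarith [pi_pos])
  have e : 2 / π * ((j:ℝ) * π / (2 * n)) = j / n := by field_simp
  rw [e] at h
  have h2 : ((j:ℝ) / n) ^ 2 ≤ sin ((j:ℝ) * π / (2 * n)) ^ 2 := by gcongr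
  rw [div_pow, div_le_iff₀ (by positivity)] at h2
  nlinarith

lemma sin_est (w : ℝ) (hw : 0 ≤ w) : w ^ 2 - sin w ^ 2 ≤ w ^ 3 := by
  rcases le_total 1 w with h | h
  · nlinarith [sq_nonneg (sin w), sq_nonneg w]
  · rcases hw.eq_or_lt with rfl | hw0
    · simp
    have h1 := sin_gt_sub_cube hw0
    have h2 := sin_le hw
    have h3 : 0 ≤ sin w := sin_nonneg_of_nonneg_of_le_pi hw (by linarith [pi_gt_three])
    have h4 : (w - sin w) * (w + sin w) ≤ (w ^ 3 / 6) * (2 * w) :=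
      mul_le_mul (by linarith) (by linarith) (by linarith) (by positivity)
    have : w ^ 3 * w ≤ w ^ 3 := mul_le_of_le_one_right (by positivity) h
    nlinarith [pow_pos hw0 3]

lemma lam_diff (n j : ℕ) (hj : 1 ≤ j) (hjn : j < n) :
    π ^ 2 * (j:ℝ) ^ 2 + lamn n j ≤ π ^ 3 / 2 * ((j:ℝ) ^ 3 / n) := by
  have hn' : (0:ℝ) < n := by exact_mod_cast (by omega : 0 < n)
  have h := sin_est ((j:ℝ) * π / (2 * n)) (by positivity)
  unfold lamn
  have := mul_le_mul_of_nonneg_left h (by positivity : (0:ℝ) ≤ 4 * n ^ 2)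
  have e1 : 4 * (n:ℝ) ^ 2 * ((j:ℝ) * π / (2 * n)) ^ 2 = π ^ 2 * j ^ 2 := by field_simp; ring
  have e2 : 4 * (n:ℝ) ^ 2 * ((j:ℝ) * π / (2 * n)) ^ 3 = π ^ 3 / 2 * ((j:ℝ) ^ 3 / n) := by
    field_simp; ring
  rw [mul_sub, e1, e2] at this
  linarith

lemma exp_diff (n j : ℕ) (hj : 1 ≤ j) (hjn : j < n) (t : ℝ) (ht : 0 < t) :
    |exp (-(j:ℝ) ^ 2 * π ^ 2 * t) - exp (lamn n j * t)|
      ≤ π ^ 3 / 4 * (j / n) * exp (-(2 * (j:ℝ) ^ 2 * t)) := by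
  have hn' : (0:ℝ) < n := by exact_mod_cast (by omega : 0 < n)
  have hj' : (0:ℝ) < j := by exact_mod_cast hj
  have hd := lam_diff n j hj hjn
  have hu := lam_upper n j hj hjn
  set L := lamn n j
  set v : ℝ := (π ^ 2 * (j:ℝ) ^ 2 + L) * t with hv
  have hv0 : 0 ≤ v := by
    have : 0 ≤ π ^ 2 * (j:ℝ) ^ 2 + L := by
      have h1 : L = -4 * (n : ℝ) ^ 2 * sin ((j : ℝ) * π / (2 * n)) ^ 2 := rfl
      have h2 : sin ((j : ℝ) * π / (2 * n)) ^ 2 ≤ ((j : ℝ) * π / (2 * n)) ^ 2 :=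
        sin_sq_le_sq
      have e1 : 4 * (n:ℝ) ^ 2 * ((j:ℝ) * π / (2 * n)) ^ 2 = π ^ 2 * j ^ 2 := by field_simp; ring
      have := mul_le_mul_of_nonneg_left h2 (by positivity : (0:ℝ) ≤ 4 * n ^ 2)
      rw [e1] at this
      rw [h1]; linarith
    positivity
  have e : exp (-(j:ℝ) ^ 2 * π ^ 2 * t) = exp (L * t) * exp (-v) := by
    rw [← exp_add]; congr 1; rw [hv]; ring
  have h1 : exp (-v) ≤ 1 := by rw [exp_le_one_iff]; linarith
  have h2 : 1 - v ≤ exp (-v) := by linarith [add_one_le_exp (-v)]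
  rw [e, abs_sub_comm, abs_of_nonneg (by nlinarith [exp_pos (L * t)])]
  have hE : exp (L * t) ≤ exp (-(2 * (j:ℝ) ^ 2 * t)) * exp (-(2 * (j:ℝ) ^ 2 * t)) := by
    rw [← exp_add, exp_le_exp]; nlinarith
  have hw : (2 * (j:ℝ) ^ 2 * t) * exp (-(2 * (j:ℝ) ^ 2 * t)) ≤ 1 := by
    rw [exp_neg, ← div_eq_mul_inv, div_le_one (exp_pos _)]
    linarith [add_one_le_exp (2 * (j:ℝ) ^ 2 * t)]
  set E := exp (-(2 * (j:ℝ) ^ 2 * t)) with hEd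
  have hEp : 0 < E := exp_pos _
  calc exp (L * t) - exp (L * t) * exp (-v) = exp (L * t) * (1 - exp (-v)) := by ring
    _ ≤ (E * E) * v := mul_le_mul hE (by linarith) (by linarith) (by positivity)
    _ ≤ (E * E) * (π ^ 3 / 2 * ((j:ℝ) ^ 3 / n) * t) := by
        rw [hv]; gcongr
    _ = π ^ 3 / 4 * (j / n) * E * ((2 * (j:ℝ) ^ 2 * t) * E) := by ring
    _ ≤ π ^ 3 / 4 * (j / n) * E := mul_le_of_le_one_right (by positivity) hw

lemma sqrt2_lt : √2 < (1.5:ℝ) := by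
  rw [sqrt_lt' (by norm_num)]; norm_num

lemma coef_diff (n j : ℕ) (hj : 1 ≤ j) (hjn : j < n) (t : ℝ) (ht : 0 < t) (x : ℝ) :
    (exp (-(j:ℝ) ^ 2 * π ^ 2 * t) * phiF j x - exp (lamn n j * t) * phiLin n j x) ^ 2
      ≤ (40 / n) ^ 2 * ((j:ℝ) ^ 2 * exp (-(4 * (j:ℝ) ^ 2 * t))) := by
  have hn' : (0:ℝ) < n := by exact_mod_cast (by omega : 0 < n)
  have h1 := exp_diff n j hj hjn t ht
  have h2 := phiLin_err n j (by omega) x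
  have h3 := phi_abs j x
  have h4 : exp (lamn n j * t) ≤ exp (-(2 * (j:ℝ) ^ 2 * t)) := by
    rw [exp_le_exp]; nlinarith [lam_upper n j hj hjn, mul_nonneg (sq_nonneg (j:ℝ)) ht.le]
  set E := exp (-(2 * (j:ℝ) ^ 2 * t)) with hE
  have hEp : 0 < E := exp_pos _
  have hEE : exp (-(4 * (j:ℝ) ^ 2 * t)) = E ^ 2 := by
    rw [hE, pow_two (exp _), ← exp_add]; congr 1; ring
  have hp3 : π ^ 3 ≤ 32 := by
    have : π ^ 3 ≤ 3.15 ^ 3 := by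
      have := pi_lt_d2
      gcongr
    linarith
  have key : |exp (-(j:ℝ) ^ 2 * π ^ 2 * t) * phiF j x - exp (lamn n j * t) * phiLin n j x|
      ≤ 40 * (j / n) * E := by
    calc _ = |(exp (-(j:ℝ) ^ 2 * π ^ 2 * t) - exp (lamn n j * t)) * phiF j x
            + exp (lamn n j * t) * (phiF j x - phiLin n j x)| := by congr 1; ring
      _ ≤ (π ^ 3 / 4 * (j / n) * E) * √2 + E * (2 * √2 * π * (j / n)) := by
          refine (abs_add_le _ _).trans ?_
          rw [abs_mul, abs_mul, abs_of_pos (exp_pos (lamn n j * t))]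
          gcongr
      _ = (π ^ 3 / 4 * √2 + 2 * √2 * π) * ((j / n) * E) := by ring
      _ ≤ 40 * ((j / n) * E) := by
          gcongr
          have := sqrt2_lt
          have := pi_lt_d2
          have h0 := sqrt_nonneg (2:ℝ)
          have : π ^ 3 / 4 * √2 ≤ 8 * 1.5 := by gcongr; linarith
          have : √2 * π ≤ 1.5 * 3.15 := by gcongr
          linarith
      _ = _ := by ring
  rw [hEE]
  calc _ = |exp (-(j:ℝ) ^ 2 * π ^ 2 * t) * phiF j x - exp (lamn n j * t) * phiLin n j x| ^ 2 := by
        rw [sq_abs]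
    _ ≤ (40 * (j / n) * E) ^ 2 := by gcongr
    _ = _ := by ring

noncomputable def hh (t : ℝ) : ℝ := exp (-t) * t ^ (-(7/8) : ℝ)

lemma hh_pos (t : ℝ) (ht : 0 < t) : 0 < hh t := by unfold hh; positivity

lemma hh_sq (t : ℝ) (ht : 0 < t) : hh t ^ 2 = exp (-(2 * t)) * t ^ (-(7/4) : ℝ) := by
  unfold hh
  rw [mul_pow, sq, ← exp_add, sq, ← rpow_add ht, ← two_mul, mul_neg]
  congr 2
  norm_num

lemma exp_rpow (u : ℝ) (hu : 0 < u) : exp (-u) ≤ 2 * u ^ (-(7/4) : ℝ) := by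
  have h1 : u ^ (7/4 : ℝ) ≤ 1 + u ^ 2 := by
    rcases le_total u 1 with h | h
    · have := rpow_le_one hu.le h (by norm_num : (0:ℝ) ≤ 7/4)
      nlinarith [sq_nonneg u]
    · have := rpow_le_rpow_of_exponent_le h (by norm_num : (7/4:ℝ) ≤ (2:ℕ))
      rw [rpow_natCast] at this
      linarith
  have h2 := quadratic_le_exp_of_nonneg hu.le
  rw [rpow_neg hu.le, exp_neg, ← div_eq_mul_inv, le_div_iff₀ (by positivity),
    inv_mul_le_iff₀ (exp_pos _)]
  linarith

noncomputable def BN (N : ℕ) (t : ℝ) : ℝ := ∑ j ∈ Ico 1 N, (j:ℝ) ^ 2 * exp (-(4 * (j:ℝ) ^ 2 * t))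

lemma BN_bound : ∃ A : ℝ, 0 < A ∧ ∀ N : ℕ, ∀ t : ℝ, 0 < t → BN N t ≤ (A * hh t) ^ 2 := by
  have hs : Summable (fun j : ℕ => (j:ℝ) ^ (-(3/2) : ℝ)) := summable_nat_rpow.mpr (by norm_num)
  set S : ℝ := ∑' j : ℕ, (j:ℝ) ^ (-(3/2) : ℝ) with hS
  have hS0 : 0 ≤ S := tsum_nonneg fun j => by positivity
  refine ⟨√(2 * S + 1), by positivity, fun N t ht => ?_⟩
  rw [mul_pow, sq_sqrt (by positivity), hh_sq t ht]
  have hterm : ∀ j ∈ Ico 1 N, (j:ℝ) ^ 2 * exp (-(4 * (j:ℝ) ^ 2 * t))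
      ≤ (2 * (exp (-(2 * t)) * t ^ (-(7/4) : ℝ))) * (j:ℝ) ^ (-(3/2) : ℝ) := by
    intro j hj
    have hj1 : (1:ℝ) ≤ j := by exact_mod_cast (mem_Ico.mp hj).1
    have hj0 : (0:ℝ) < j := by linarith
    have e1 : exp (-(4 * (j:ℝ) ^ 2 * t)) ≤ exp (-(2 * t)) * exp (-((j:ℝ) ^ 2 * t)) := by
      rw [← exp_add, exp_le_exp]
      have : (1:ℝ) ≤ j ^ 2 := by nlinarith
      nlinarith
    have e2 := exp_rpow ((j:ℝ) ^ 2 * t) (by positivity)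
    have e3 : ((j:ℝ) ^ 2 * t) ^ (-(7/4) : ℝ) = (j:ℝ) ^ (-(7/2) : ℝ) * t ^ (-(7/4) : ℝ) := by
      rw [mul_rpow (by positivity) ht.le, ← rpow_natCast, ← rpow_mul hj0.le]
      norm_num
    have e4 : (j:ℝ) ^ 2 * (j:ℝ) ^ (-(7/2) : ℝ) = (j:ℝ) ^ (-(3/2) : ℝ) := by
      rw [← rpow_natCast, ← rpow_add hj0]; norm_num
    rw [e3] at e2
    calc (j:ℝ) ^ 2 * exp (-(4 * (j:ℝ) ^ 2 * t))
        ≤ (j:ℝ) ^ 2 * (exp (-(2 * t)) * (2 * ((j:ℝ) ^ (-(7/2) : ℝ) * t ^ (-(7/4) : ℝ)))) := by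
          gcongr
          exact e1.trans (by gcongr)
      _ = (2 * (exp (-(2 * t)) * t ^ (-(7/4) : ℝ))) * ((j:ℝ) ^ 2 * (j:ℝ) ^ (-(7/2) : ℝ)) := by ring
      _ = _ := by rw [e4]
  have hX : 0 < exp (-(2 * t)) * t ^ (-(7/4) : ℝ) := by positivity
  calc BN N t ≤ ∑ j ∈ Ico 1 N, (2 * (exp (-(2 * t)) * t ^ (-(7/4) : ℝ))) * (j:ℝ) ^ (-(3/2) : ℝ) :=
        sum_le_sum hterm
    _ = (2 * (exp (-(2 * t)) * t ^ (-(7/4) : ℝ))) * ∑ j ∈ Ico 1 N, (j:ℝ) ^ (-(3/2) : ℝ) := by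
        rw [mul_sum]
    _ ≤ (2 * (exp (-(2 * t)) * t ^ (-(7/4) : ℝ))) * S := by
        gcongr
        exact hs.sum_le_tsum _ fun j _ => by positivity
    _ ≤ _ := by nlinarith

end Aux
namespace Aux
open Real Finset

lemma l1_le (f : ℝ → ℝ) (B : ℝ) (hB : 0 ≤ B) (hf : IntervalIntegrable f volume 0 1)
    (hf2 : IntervalIntegrable (fun y => f y ^ 2) volume 0 1)
    (h : ∫ y in (0:ℝ)..1, f y ^ 2 ≤ B ^ 2) : ∫ y in (0:ℝ)..1, |f y| ≤ B := by
  have := cs_int (fun y => |f y|) 0 1 zero_le_one hf.abs (by simpa only [sq_abs] using hf2)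
  simp only [sq_abs, sub_zero, one_mul] at this
  exact abs_le_of_sq_le_sq' (this.trans h) hB |>.2

noncomputable def cf (t x : ℝ) (j : ℕ) : ℝ := exp (-(j:ℝ) ^ 2 * π ^ 2 * t) * phiF j x

noncomputable def GN (N : ℕ) (t x y : ℝ) : ℝ := ∑ j ∈ Ico 1 N, cf t x j * phiF j y

lemma cf_sq (t x : ℝ) (ht : 0 < t) (j : ℕ) : cf t x j ^ 2 ≤ 2 * exp (-(4 * (j:ℝ) ^ 2 * t)) := by
  unfold cf
  have h1 : phiF j x ^ 2 ≤ 2 := by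
    have := phi_abs j x
    rw [← sq_abs]
    calc |phiF j x| ^ 2 ≤ √2 ^ 2 := by gcongr
      _ = 2 := sq_sqrt (by norm_num)
  have h2 : exp (-(j:ℝ) ^ 2 * π ^ 2 * t) ^ 2 ≤ exp (-(4 * (j:ℝ) ^ 2 * t)) := by
    rw [pow_two (exp _), ← exp_add, exp_le_exp]
    have h3 : (2:ℝ) ≤ π ^ 2 := by nlinarith [pi_gt_three]
    have := mul_le_mul_of_nonneg_left h3 (by positivity : 0 ≤ (j:ℝ) ^ 2 * t)
    nlinarith
  rw [mul_pow, mul_comm 2]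
  exact mul_le_mul h2 h1 (sq_nonneg _) (exp_pos _).le

lemma Icc_subset_bound (n N : ℕ) (hn : 2 ≤ n) (hN : n ≤ N) (t : ℝ) :
    ∑ j ∈ Icc 1 (n-1), (j:ℝ) ^ 2 * exp (-(4 * (j:ℝ) ^ 2 * t)) ≤ BN N t := by
  apply sum_le_sum_of_subset_of_nonneg
  · intro j; simp; omega
  · intro j _ _; positivity

lemma Ico_subset_bound (n N : ℕ) (hn : 2 ≤ n) (t : ℝ) :
    ∑ j ∈ Ico n N, (j:ℝ) ^ 2 * exp (-(4 * (j:ℝ) ^ 2 * t)) ≤ BN N t := by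
  apply sum_le_sum_of_subset_of_nonneg
  · intro j; simp; omega
  · intro j _ _; positivity

lemma fin_est (A : ℝ) (hA : 0 < A)
    (hB : ∀ N : ℕ, ∀ t : ℝ, 0 < t → BN N t ≤ (A * hh t) ^ 2)
    (n N : ℕ) (hn : 2 ≤ n) (hN : n ≤ N) (t : ℝ) (ht : 0 < t) (x : ℝ) :
    ∫ y in (0:ℝ)..1, |GN N t x y - Gn n t x y| ≤ 120 * A / n * hh t := by
  have hn' : (0:ℝ) < n := by exact_mod_cast (by omega : 0 < n)
  have hnpos : 0 < n := by omega
  have hhp := hh_pos t ht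
  set R : ℝ := 40 / n * (A * hh t) with hR
  have hR0 : 0 ≤ R := by positivity
  have hBR : (40 / n) ^ 2 * BN N t ≤ R ^ 2 := by
    rw [hR, mul_pow]; gcongr; exact hB N t ht
  set T1 : ℝ → ℝ := fun y => ∑ j ∈ Ico n N, cf t x j * phiF j y with hT1
  set d : ℕ → ℝ := fun j => cf t x j - exp (lamn n j * t) * phiLin n j x with hd
  set D : ℝ → ℝ := fun a => ∑ j ∈ Icc 1 (n-1), d j * phiF j a with hD
  set g : ℝ → ℝ := fun y => ∑ j ∈ Icc 1 (n-1), cf t x j * phiF j y with hg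
  set g' : ℝ → ℝ := fun y => ∑ j ∈ Icc 1 (n-1), (cf t x j * √2 * (j * π)) * cos (j * π * y) with hg'
  have cT1 : Continuous T1 := by
    rw [hT1]; exact continuous_finsetSum _ fun j _ => continuous_const.mul (phi_cont j)
  have cg : Continuous g := by
    rw [hg]; exact continuous_finsetSum _ fun j _ => continuous_const.mul (phi_cont j)
  have cg' : Continuous g' := by
    rw [hg']; exact continuous_finsetSum _ fun j _ => by fun_prop
  have dg : ∀ y, HasDerivAt g (g' y) y := by
    intro y
    rw [hg, hg']
    apply HasDerivAt.fun_sum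
    intro j _
    unfold phiF
    have h1 : HasDerivAt (fun y : ℝ => (j:ℝ) * π * y) (j * π) y := by
      simpa using (hasDerivAt_id y).const_mul ((j:ℝ) * π)
    have h2 := ((h1.sin).const_mul √2).const_mul (cf t x j)
    refine h2.congr_deriv ?_
    ring
  have b1 : ∫ y in (0:ℝ)..1, |T1 y| ≤ R := by
    apply l1_le _ _ hR0 (cT1.intervalIntegrable _ _) ((cT1.pow 2).intervalIntegrable _ _)
    rw [hT1, sq_phi _ (fun j hj => by rw [mem_Ico] at hj; omega)]
    refine le_trans ?_ hBR
    refine le_trans ?_ (mul_le_mul_of_nonneg_left (Ico_subset_bound n N hn t) (by positivity))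
    rw [mul_sum]
    apply sum_le_sum
    intro j hj
    refine (cf_sq t x ht j).trans ?_
    have hj' : (n:ℝ) ≤ j := by exact_mod_cast (mem_Ico.mp hj).1
    rw [← mul_assoc]
    gcongr
    rw [div_pow, div_mul_eq_mul_div, le_div_iff₀ (by positivity)]
    have : (n:ℝ) ^ 2 ≤ j ^ 2 := by gcongr
    nlinarith
  have iD := step_int' n hnpos D
  have iD2 := step_int' n hnpos (fun a => D a ^ 2)
  have b2 : ∫ y in (0:ℝ)..1, |D (kappa n y)| ≤ R := by
    apply l1_le (fun y => D (kappa n y)) _ hR0 iD.1 iD2.1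
    rw [hD, sq_phi_kappa n hn]
    refine le_trans ?_ hBR
    refine le_trans ?_ (mul_le_mul_of_nonneg_left (Icc_subset_bound n N hn hN t) (by positivity))
    rw [mul_sum]
    apply sum_le_sum
    intro j hj
    rw [mem_Icc] at hj
    exact coef_diff n j (by omega) (by omega) t ht x
  have ig := step_int n hnpos (fun y a => g y - g a) (fun a => by fun_prop)
  have ig2 := step_int n hnpos (fun y a => (g y - g a) ^ 2) (fun a => by fun_prop)
  have b3 : ∫ y in (0:ℝ)..1, |g y - g (kappa n y)| ≤ R := by
    apply l1_le (fun y => g y - g (kappa n y)) _ hR0 ig.1 ig2.1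
    refine (poincare n hnpos g g' dg cg').trans ?_
    rw [hg', sq_cos _ (fun j hj => by rw [mem_Icc] at hj; omega)]
    refine le_trans ?_ hBR
    refine le_trans ?_ (mul_le_mul_of_nonneg_left (Icc_subset_bound n N hn hN t) (by positivity))
    rw [mul_sum, mul_sum]
    apply sum_le_sum
    intro j hj
    have h1 := cf_sq t x ht j
    have hp : π ^ 2 ≤ 10 := by nlinarith [pi_lt_d2, pi_pos]
    calc (1 / (n:ℝ)) ^ 2 * ((cf t x j * √2 * (j * π)) ^ 2 * (1/2))
        = (1 / (n:ℝ)) ^ 2 * (j ^ 2 * (cf t x j ^ 2 * π ^ 2)) := by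
          rw [mul_pow, mul_pow (cf t x j), sq_sqrt (by norm_num)]; ring
      _ ≤ (1 / (n:ℝ)) ^ 2 * (j ^ 2 * (2 * exp (-(4 * (j:ℝ) ^ 2 * t)) * 10)) := by gcongr
      _ ≤ (40 / (n:ℝ)) ^ 2 * (j ^ 2 * exp (-(4 * (j:ℝ) ^ 2 * t))) := by
          have : 0 ≤ (1 / (n:ℝ)) ^ 2 * (j ^ 2 * exp (-(4 * (j:ℝ) ^ 2 * t))) := by positivity
          rw [show (40:ℝ) / n = 40 * (1 / n) by ring, mul_pow]
          nlinarith
  have hdec : ∀ y, GN N t x y - Gn n t x y = T1 y + D (kappa n y) + (g y - g (kappa n y)) := by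
    intro y
    have e1 : GN N t x y = g y + T1 y := by
      unfold GN
      rw [hg, hT1, ← sum_Ico_consecutive _ (by omega : 1 ≤ n) hN]
      congr 1
    have e2 : D (kappa n y) = g (kappa n y) - Gn n t x y := by
      unfold Gn
      rw [hD, hg, ← sum_sub_distrib]
      exact sum_congr rfl fun j _ => by rw [hd]; ring
    rw [e1, e2]; ring
  simp_rw [hdec]
  have i1 : IntervalIntegrable (fun y => |T1 y|) volume 0 1 := cT1.abs.intervalIntegrable _ _
  calc ∫ y in (0:ℝ)..1, |T1 y + D (kappa n y) + (g y - g (kappa n y))|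
      ≤ ∫ y in (0:ℝ)..1, (|T1 y| + |D (kappa n y)| + |g y - g (kappa n y)|) := by
        apply intervalIntegral.integral_mono_on zero_le_one
        · exact (((cT1.intervalIntegrable _ _).add iD.1).add ig.1).abs
        · exact (i1.add iD.1.abs).add ig.1.abs
        · intro y _
          exact abs_add_three _ _ _
    _ = (∫ y in (0:ℝ)..1, |T1 y|) + (∫ y in (0:ℝ)..1, |D (kappa n y)|)
        + ∫ y in (0:ℝ)..1, |g y - g (kappa n y)| := by
        rw [intervalIntegral.integral_add (i1.add iD.1.abs) ig.1.abs,
          intervalIntegral.integral_add i1 iD.1.abs]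
    _ ≤ R + R + R := by linarith
    _ = _ := by rw [hR]; ring

lemma G_unif (t x : ℝ) (ht : 0 < t) :
    TendstoUniformly (fun M y => GN (M + 1) t x y) (fun y => G t x y) Filter.atTop ∧
    Continuous (fun y => G t x y) := by
  have hu : Summable (fun i : ℕ => 2 * exp (-(π ^ 2 * t)) ^ i) := by
    apply Summable.mul_left
    apply summable_geometric_of_lt_one (exp_pos _).le
    rw [exp_lt_one_iff]
    have : 0 < π ^ 2 * t := by positivity
    linarith
  have hb : ∀ (i : ℕ) (y : ℝ),
      ‖exp (-((i : ℝ) + 1) ^ 2 * π ^ 2 * t) * phiF (i + 1) x * phiF (i + 1) y‖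
        ≤ 2 * exp (-(π ^ 2 * t)) ^ i := by
    intro i y
    rw [norm_eq_abs, abs_mul, abs_mul, abs_of_pos (exp_pos _), mul_assoc, mul_comm 2]
    have h1 : exp (-((i : ℝ) + 1) ^ 2 * π ^ 2 * t) ≤ exp (-(π ^ 2 * t)) ^ i := by
      rw [← exp_nat_mul, exp_le_exp]
      have h3 : (i:ℝ) ≤ (i + 1) ^ 2 := by nlinarith [(Nat.cast_nonneg i : (0:ℝ) ≤ i)]
      have := mul_le_mul_of_nonneg_right h3 (by positivity : 0 ≤ π ^ 2 * t)
      nlinarith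
    have h2 : |phiF (i+1) x| * |phiF (i+1) y| ≤ 2 := by
      calc _ ≤ √2 * √2 := by
            gcongr
            · exact phi_abs _ _
            · exact phi_abs _ _
        _ = 2 := mul_self_sqrt (by norm_num)
    gcongr
  constructor
  · have := tendstoUniformly_tsum_nat hu hb
    convert this using 3 with M y
    unfold GN cf
    rw [sum_Ico_eq_sum_range]
    apply sum_congr rfl
    intro i _
    rw [add_comm 1 i]
    push_cast
    rfl
    rfl
  · exact continuous_tsum (fun i => continuous_const.mul (phi_cont _)) hu hb

lemma Gn_int (n : ℕ) (hn : 2 ≤ n) (t x : ℝ) :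
    IntervalIntegrable (fun y => Gn n t x y) volume 0 1 :=
  (step_int' n (by omega) (fun a => ∑ j ∈ Icc 1 (n - 1), exp (lamn n j * t) * phiLin n j x * phiF j a)).1

lemma GN_cont (N : ℕ) (t x : ℝ) : Continuous (fun y => GN N t x y) :=
  continuous_finsetSum _ fun j _ => continuous_const.mul (phi_cont j)

lemma main_est : ∃ C : ℝ, 0 < C ∧ ∀ n : ℕ, 2 ≤ n → ∀ t : ℝ, 0 < t → ∀ x : ℝ,
    ∫ y in (0:ℝ)..1, |G t x y - Gn n t x y| ≤ C / n * hh t := by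
  obtain ⟨A, hA, hB⟩ := BN_bound
  refine ⟨120 * A, by positivity, fun n hn t ht x => ?_⟩
  apply le_of_forall_pos_le_add
  intro ε hε
  obtain ⟨hU, hC⟩ := G_unif t x ht
  have h1 := (Metric.tendstoUniformly_iff.mp hU) ε hε
  obtain ⟨M, hM, hMn⟩ := (h1.and (Filter.eventually_ge_atTop n)).exists
  have h2 := fin_est A hA hB n (M + 1) hn (by omega) t ht x
  have i2 := ((GN_cont (M+1) t x).intervalIntegrable (μ := volume) 0 1).sub (Gn_int n hn t x)
  calc ∫ y in (0:ℝ)..1, |G t x y - Gn n t x y|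
      ≤ ∫ y in (0:ℝ)..1, (|GN (M+1) t x y - Gn n t x y| + ε) := by
        apply intervalIntegral.integral_mono_on zero_le_one
        · exact ((hC.intervalIntegrable _ _).sub (Gn_int n hn t x)).abs
        · exact i2.abs.add intervalIntegrable_const
        · intro y _
          have := (hM y).le
          rw [dist_eq] at this
          have h4 := abs_sub_le (G t x y) (GN (M+1) t x y) (Gn n t x y)
          linarith
    _ = (∫ y in (0:ℝ)..1, |GN (M+1) t x y - Gn n t x y|) + ε := by
        rw [intervalIntegral.integral_add i2.abs intervalIntegrable_const]
        simp
    _ ≤ _ := by linarith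

lemma Gn_bound (n : ℕ) (hn : 2 ≤ n) (t : ℝ) (ht : 0 < t) (x : ℝ) (hx : x ∈ Set.Icc (0:ℝ) 1) :
    ∫ y in (0:ℝ)..1, |Gn n t x y| ≤ 1 := by
  have hn' : (0:ℝ) < n := by exact_mod_cast (by omega : 0 < n)
  have h := (step_int' n (by omega) (fun a => |∑ j ∈ Icc 1 (n - 1),
    exp (lamn n j * t) * phiLin n j x * phiF j a|)).2
  unfold Gn
  rw [h, div_le_one hn']
  obtain ⟨i, hi⟩ : ∃ i : ℕ, ⌊(n:ℝ) * x⌋ = (i:ℤ) :=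
    Int.eq_ofNat_of_zero_le (Int.floor_nonneg.mpr (mul_nonneg hn'.le hx.1))
  have f1 : (i:ℝ) ≤ n * x := by
    have := Int.floor_le ((n:ℝ) * x); rw [hi] at this; exact_mod_cast this
  have f2 : n * x < i + 1 := by
    have := Int.lt_floor_add_one ((n:ℝ) * x); rw [hi] at this; exact_mod_cast this
  set θ : ℝ := n * x - i with hθ
  have e : ∀ k : ℕ, ∑ j ∈ Icc 1 (n - 1), exp (lamn n j * t) * phiLin n j x * phiF j ((k:ℝ)/n)
      = (1 - θ) * un n t i k + θ * un n t (i+1) k := by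
    intro k
    unfold un
    rw [mul_sum, mul_sum, ← sum_add_distrib]
    apply sum_congr rfl
    intro j _
    unfold phiLin
    rw [hi]
    push_cast
    rw [← hθ]
    ring
  simp_rw [e]
  have hin : i ≤ n := by
    have : (i:ℝ) ≤ n := by nlinarith [hx.2]
    exact_mod_cast this
  have hsum : ∑ k ∈ range n, |(1 - θ) * un n t i k + θ * un n t (i+1) k|
      ≤ (1 - θ) * ∑ k ∈ range n, |un n t i k| + θ * ∑ k ∈ range n, |un n t (i+1) k| := by
    rw [mul_sum, mul_sum, ← sum_add_distrib]
    apply sum_le_sum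
    intro k _
    refine (abs_add_le _ _).trans ?_
    rw [abs_mul, abs_mul, abs_of_nonneg (by linarith : 0 ≤ 1 - θ), abs_of_nonneg (by linarith : 0 ≤ θ)]
  refine hsum.trans ?_
  have b1 := un_bound n hn t ht.le i hin
  rcases hin.eq_or_lt with h | h
  · have : θ = 0 := by
      have : (i:ℝ) = n := by exact_mod_cast h
      have := hx.2
      apply le_antisymm <;> nlinarith
    rw [this]; linarith
  · have b2 := un_bound n hn t ht.le (i+1) (by omega)
    have := mul_le_mul_of_nonneg_left b1 (by linarith : 0 ≤ 1 - θ)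
    have := mul_le_mul_of_nonneg_left b2 (by linarith : 0 ≤ θ)
    linarith

lemma G_bound (t : ℝ) (ht : 0 < t) (x : ℝ) (hx : x ∈ Set.Icc (0:ℝ) 1) :
    ∫ y in (0:ℝ)..1, |G t x y| ≤ 1 := by
  obtain ⟨C, hC, hm⟩ := main_est
  have hT : Filter.Tendsto (fun n : ℕ => 1 + C / n * hh t) Filter.atTop (nhds (1 + 0 * hh t)) :=
    ((tendsto_const_div_atTop_nhds_zero_nat C).mul_const _).const_add _
  rw [zero_mul, add_zero] at hT
  refine ge_of_tendsto hT ?_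
  filter_upwards [Filter.eventually_ge_atTop 2] with n hn
  have h1 := hm n hn t ht x
  have h2 := Gn_bound n hn t ht x hx
  have iG := ((G_unif t x ht).2).intervalIntegrable (μ := volume) 0 1
  have iN := Gn_int n hn t x
  calc ∫ y in (0:ℝ)..1, |G t x y|
      ≤ ∫ y in (0:ℝ)..1, (|Gn n t x y| + |G t x y - Gn n t x y|) := by
        apply intervalIntegral.integral_mono_on zero_le_one iG.abs (iN.abs.add (iG.sub iN).abs)
        intro y _
        have := abs_add_le (Gn n t x y) (G t x y - Gn n t x y)
        rwa [add_sub_cancel] at this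
    _ = (∫ y in (0:ℝ)..1, |Gn n t x y|) + ∫ y in (0:ℝ)..1, |G t x y - Gn n t x y| :=
        intervalIntegral.integral_add iN.abs (iG.sub iN).abs
    _ ≤ _ := by linarith

end Aux
namespace Aux
open Real

lemma prod_diff {ι : Type*} [DecidableEq ι] (s : Finset ι) (a b : ι → ℝ) :
    |∏ i ∈ s, a i - ∏ i ∈ s, b i| ≤
      ∑ i ∈ s, ∏ k ∈ s, (if k = i then |a k - b k| else |a k| + |b k|) := by
  induction s using Finset.induction_on with
  | empty => simp
  | insert j s hj ih =>
    rw [Finset.prod_insert hj, Finset.prod_insert hj, Finset.sum_insert hj, Finset.prod_insert hj]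
    have e1 : ∏ k ∈ s, (if k = j then |a k - b k| else |a k| + |b k|) = ∏ k ∈ s, (|a k| + |b k|) :=
      Finset.prod_congr rfl fun k hk => if_neg (by rintro rfl; exact hj hk)
    have e2 : ∑ i ∈ s, ∏ k ∈ insert j s, (if k = i then |a k - b k| else |a k| + |b k|)
        = (|a j| + |b j|) * ∑ i ∈ s, ∏ k ∈ s, (if k = i then |a k - b k| else |a k| + |b k|) := by
      rw [Finset.mul_sum]
      refine Finset.sum_congr rfl fun i hi => ?_
      rw [Finset.prod_insert hj, if_neg (by rintro rfl; exact hj hi)]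
    rw [e1, e2, if_pos rfl]
    have h1 : |∏ i ∈ s, a i| ≤ ∏ k ∈ s, (|a k| + |b k|) := by
      rw [Finset.abs_prod]
      exact Finset.prod_le_prod (fun _ _ => abs_nonneg _)
        fun k _ => le_add_of_nonneg_right (abs_nonneg _)
    calc |a j * ∏ i ∈ s, a i - b j * ∏ i ∈ s, b i|
        = |(a j - b j) * ∏ i ∈ s, a i + b j * (∏ i ∈ s, a i - ∏ i ∈ s, b i)| := by congr 1; ring
      _ ≤ |a j - b j| * |∏ i ∈ s, a i| + |b j| * |∏ i ∈ s, a i - ∏ i ∈ s, b i| := by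
          rw [← abs_mul, ← abs_mul]; exact abs_add_le _ _
      _ ≤ |a j - b j| * ∏ k ∈ s, (|a k| + |b k|) + (|a j| + |b j|) *
          ∑ i ∈ s, ∏ k ∈ s, (if k = i then |a k - b k| else |a k| + |b k|) := by
          gcongr
          linarith [abs_nonneg (a j)]

lemma Q_int (d : ℕ) (F : (Fin d → ℝ) → ℝ) :
    ∫ y in Q d, F (fun i => y i) = ∫ y, F y ∂(Measure.pi fun _ : Fin d => volume.restrict (Set.Icc (0:ℝ) 1)) := by
  rw [← Measure.restrict_pi_pi]
  have h := (EuclideanSpace.volume_preserving_symm_measurableEquiv_toLp (Fin d)).setIntegral_preimage_emb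
    (MeasurableEquiv.measurableEmbedding _) F (Set.univ.pi fun _ => Set.Icc (0:ℝ) 1)
  rw [← volume_pi, ← h]
  have : (⇑(MeasurableEquiv.toLp 2 (Fin d → ℝ)).symm ⁻¹' Set.univ.pi fun _ => Set.Icc (0:ℝ) 1) = Q d := by
    ext y
    simp [Q, Pi.le_def, forall_and]
  rw [this]
  rfl

lemma dd_est (d : ℕ) (a b : Fin d → ℝ → ℝ) (δ : ℝ) (hδ : 0 ≤ δ)
    (ia : ∀ i, IntervalIntegrable (a i) volume 0 1)
    (ib : ∀ i, IntervalIntegrable (b i) volume 0 1)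
    (ha : ∀ i, ∫ y in (0:ℝ)..1, |a i y| ≤ 1) (hb : ∀ i, ∫ y in (0:ℝ)..1, |b i y| ≤ 1)
    (hab : ∀ i, ∫ y in (0:ℝ)..1, |a i y - b i y| ≤ δ) :
    ∫ y in Q d, |∏ i, a i (y i) - ∏ i, b i (y i)| ≤ d * 2 ^ d * δ := by
  rw [Q_int d (fun y => |∏ i, a i (y i) - ∏ i, b i (y i)|)]
  have conv : ∀ f : ℝ → ℝ, ∫ y in Set.Icc (0:ℝ) 1, f y = ∫ y in (0:ℝ)..1, f y := by
    intro f
    rw [intervalIntegral.integral_of_le zero_le_one, integral_Icc_eq_integral_Ioc]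
  have convI : ∀ f : ℝ → ℝ, IntervalIntegrable f volume 0 1 →
      Integrable f (volume.restrict (Set.Icc (0:ℝ) 1)) := by
    intro f hf
    exact (intervalIntegrable_iff_integrableOn_Icc_of_le zero_le_one).mp hf
  set c : Fin d → Fin d → ℝ → ℝ := fun i k y =>
    if k = i then |a k y - b k y| else |a k y| + |b k y| with hc
  have ic : ∀ i k, IntervalIntegrable (c i k) volume 0 1 := by
    intro i k
    by_cases h : k = i
    · simpa only [hc, if_pos h] using ((ia k).sub (ib k)).abs
    · simpa only [hc, if_neg h] using (ia k).abs.add (ib k).abs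
  have ip : ∀ i, Integrable (fun y : Fin d → ℝ => ∏ k, c i k (y k))
      (Measure.pi fun _ : Fin d => volume.restrict (Set.Icc (0:ℝ) 1)) := fun i =>
    Integrable.fintype_prod fun k => convI _ (ic i k)
  have c0 : ∀ i k y, 0 ≤ c i k y := by
    intro i k y
    simp only [hc]
    split_ifs <;> positivity
  have cnn : ∀ i k, 0 ≤ ∫ y in (0:ℝ)..1, c i k y := fun i k =>
    intervalIntegral.integral_nonneg zero_le_one fun y _ => c0 i k y
  calc _ ≤ ∫ y, (∑ i, ∏ k, c i k (y k))
        ∂(Measure.pi fun _ : Fin d => volume.restrict (Set.Icc (0:ℝ) 1)) := by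
        apply integral_mono_of_nonneg
        · exact Filter.Eventually.of_forall fun y => abs_nonneg _
        · exact integrable_finsetSum _ fun i _ => ip i
        · exact Filter.Eventually.of_forall fun y =>
            prod_diff Finset.univ (fun i => a i (y i)) (fun i => b i (y i))
    _ = ∑ i, ∏ k, ∫ y in (0:ℝ)..1, c i k y := by
        rw [integral_finsetSum _ fun i _ => ip i]
        refine Finset.sum_congr rfl fun i _ => ?_
        rw [integral_fintype_prod_eq_prod (𝕜 := ℝ) (fun k => c i k)]
        exact Finset.prod_congr rfl fun k _ => conv _
    _ ≤ ∑ i : Fin d, 2 ^ d * δ := by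
        refine Finset.sum_le_sum fun i _ => ?_
        calc ∏ k, ∫ y in (0:ℝ)..1, c i k y ≤ ∏ k : Fin d, (2 * if k = i then δ else 1) := by
              refine Finset.prod_le_prod (fun k _ => cnn i k) fun k _ => ?_
              by_cases h : k = i
              · simp only [hc, if_pos h]
                linarith [hab k]
              · simp only [hc, if_neg h]
                rw [intervalIntegral.integral_add (ia k).abs (ib k).abs]
                linarith [ha k, hb k]
          _ = 2 ^ d * δ := by
              rw [Finset.prod_mul_distrib]
              simp
    _ = d * 2 ^ d * δ := by simp; ring

end Aux

/-- time-integrated uniform `L¹` estimate of `G_d - (G_d)^n`. -/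
theorem stmt_14 (d : ℕ) (hd : 1 ≤ d) :
    ∃ C : ℝ, 0 < C ∧ ∀ n : ℕ, 2 ≤ n →
      (∫ t in Set.Ioi (0 : ℝ), ⨆ x ∈ Q d, ∫ y in Q d, |Gd d t x y - Gdn d n t x y|)
        ≤ C * (n : ℝ)⁻¹ := by
  obtain ⟨C, hC, hm⟩ := Aux.main_est
  have hd' : (0:ℝ) < d := by exact_mod_cast hd
  have hΓ : 0 < Real.Gamma (1/8) := Real.Gamma_pos_of_pos (by norm_num)
  refine ⟨d * 2 ^ d * C * Real.Gamma (1/8), by positivity, fun n hn => ?_⟩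
  have hn' : (0:ℝ) < n := by exact_mod_cast (by omega : 0 < n)
  have hI : IntegrableOn Aux.hh (Set.Ioi 0) := by
    have := Real.GammaIntegral_convergent (s := 1/8) (by norm_num)
    norm_num at this
    unfold Aux.hh
    norm_num
    exact this
  have hV : ∫ t in Set.Ioi (0:ℝ), Aux.hh t = Real.Gamma (1/8) := by
    rw [Real.Gamma_eq_integral (by norm_num)]
    unfold Aux.hh
    norm_num
  calc _ ≤ ∫ t in Set.Ioi (0 : ℝ), (d * 2 ^ d * (C / n)) * Aux.hh t := by
        apply integral_mono_of_nonneg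
        · exact Filter.Eventually.of_forall fun t => Real.iSup_nonneg fun x =>
            Real.iSup_nonneg fun _ => integral_nonneg fun y => abs_nonneg _
        · exact hI.const_mul _
        · filter_upwards [ae_restrict_mem measurableSet_Ioi] with t ht
          have ht' : 0 < t := ht
          have hh0 := Aux.hh_pos t ht'
          refine Real.iSup_le (fun x => Real.iSup_le (fun hx => ?_) (by positivity)) (by positivity)
          rw [mul_assoc _ (C / n)]
          unfold Gd Gdn
          exact Aux.dd_est d (fun i => G t (x i)) (fun i => Gn n t (x i)) _ (by positivity)
            (fun i => ((Aux.G_unif t (x i) ht').2).intervalIntegrable _ _)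
            (fun i => Aux.Gn_int n hn t (x i))
            (fun i => Aux.G_bound t ht' (x i) (hx i))
            (fun i => Aux.Gn_bound n hn t ht' (x i) (hx i))
            (fun i => hm n hn t ht' (x i))
    _ = _ := by
        rw [integral_const_mul, hV]
        ring
end
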